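/- arXiv:2204.10642 — 2 statements merged into one kernel-verified Lean document; each statement's English description precedes it below -/
import Mathlib

section
/- Let s > 0, 0 < ε < s and set η = s − ε, and let c, C > 0. There exists N₀ (depending only on c and η) such that the following holds for every finite group G with |G| ≥ N₀ and 𝔇(G) ≥ |G|^s, where 𝔇(G) is the minimum of dim V over all non-trivial irreducible complex representations of G: for every symmetric subset S ⊆ G and every partition of G into subsets A_1, …, A_m with c·|G|^{1−η} ≤ |A_i| ≤ C·|G|^{1−η} for all i, there exists an orthonormal basis B of ℓ²(G) consisting of real-valued eigenfunctions of the adjacency operator of Cay(G, S) such that for every i and every φ ∈ B one has |Σ_{g∈A_i} |φ(g)|² − |A_i|/|G|| ≤ (128/√c)·log(|G|)/|G|^{ε/2} · |A_i|/|G|. -/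
open scoped BigOperators

/-- A bundled non-trivial irreducible finite-dimensional complex representation of `G`. -/
structure NontrivIrrep (G : Type) [Group G] : Type 1 where
  W : Type
  [acg : AddCommGroup W]
  [mod : Module ℂ W]
  [fd : FiniteDimensional ℂ W]
  ρ : Representation ℂ G W
  irr : ∀ U : Submodule ℂ W, (∀ g : G, ∀ x ∈ U, ρ g x ∈ U) → U = ⊥ ∨ U = ⊤
  nontriv : ∃ g : G, ρ g ≠ 1

attribute [instance] NontrivIrrep.acg NontrivIrrep.mod NontrivIrrep.fd

def sg (b : Bool) : ℝ := if b then 1 else -1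

lemma sg_sq (b : Bool) : sg b * sg b = 1 := by cases b <;> simp [sg]

lemma chaos (t H0 : ℝ) (ht : 0 ≤ t) (hH0 : 0 < H0) (htH : 4 * t * H0 ≤ 1) :
    ∀ (n : ℕ) (M : Fin n → Fin n → ℝ), (∀ i j, M i j = M j i) → ∀ H : ℝ, 0 ≤ H → H ≤ H0 →
      (∑ i, ∑ j, M i j ^ 2) ≤ H ^ 2 →
      ∑ σ : Fin n → Bool, Real.exp (t * ((∑ i, ∑ j, sg (σ i) * sg (σ j) * M i j) - ∑ i, M i i))
        ≤ 2 ^ n * Real.exp (4 * t ^ 2 * H0 * H) := by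
  intro n
  induction n with
  | zero =>
    intro M _ H hH _ _
    simp
    positivity
  | succ n ih =>
    intro M hM H hH hHH0 hS
    set b : Fin n → ℝ := fun j => M 0 j.succ with hb
    set β : ℝ := ∑ j, b j ^ 2 with hβ
    set P2 : ℝ := ∑ i : Fin n, ∑ j : Fin n, M i.succ j.succ ^ 2 with hP2
    have hβ0 : 0 ≤ β := Finset.sum_nonneg fun _ _ => sq_nonneg _
    have hP20 : 0 ≤ P2 := Finset.sum_nonneg fun _ _ => Finset.sum_nonneg fun _ _ => sq_nonneg _
    have hS' : M 0 0 ^ 2 + 2 * β + P2 ≤ H ^ 2 := by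
      have : ∑ i, ∑ j, M i j ^ 2 = M 0 0 ^ 2 + 2 * β + P2 := by
        simp only [Fin.sum_univ_succ, Finset.sum_add_distrib]
        have : ∑ i : Fin n, M i.succ 0 ^ 2 = β := by
          simp only [hβ, hb, hM 0]
        rw [this]; ring
      linarith
    have hS2 : 2 * β + P2 ≤ H ^ 2 := by nlinarith [sq_nonneg (M 0 0)]
    set K : ℝ := H - β / H0 with hK
    have hβH : β / H0 ≤ H / 2 := by
      rw [div_le_iff₀ hH0]; nlinarith
    have hK0 : 0 ≤ K := by rw [hK]; linarith
    have hβd : β = (β / H0) * H0 := by field_simp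
    have hbd0 : 0 ≤ β / H0 := by positivity
    have hPK : P2 ≤ K ^ 2 := by
      have h1 : (β / H0) * H ≤ (β / H0) * H0 := mul_le_mul_of_nonneg_left hHH0 hbd0
      rw [hK]; nlinarith [sq_nonneg (β / H0)]
    set H' : ℝ := H - β / H0 / 2 with hH'
    have hH'0 : 0 ≤ H' := by rw [hH']; linarith
    have hH'1 : H' ≤ H0 := by rw [hH']; linarith
    have hKH : K + 2 * t * β ≤ H' := by
      have : 2 * t * β ≤ β / H0 / 2 := by
        have : 4 * t * H0 * (β / H0) ≤ 1 * (β / H0) := mul_le_mul_of_nonneg_right htH hbd0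
        have h3 : 4 * t * H0 * (β / H0) = 4 * t * β := by field_simp
        linarith
      rw [hK, hH']; linarith
    set M' : Fin n → Fin n → ℝ := fun i j => M i.succ j.succ + 2 * t * (b i * b j) with hM'
    have hM's : ∀ i j, M' i j = M' j i := by
      intro i j; simp only [hM']; rw [hM i.succ j.succ]; ring
    have hbb : ∑ i, ∑ j, (b i * b j) ^ 2 = β ^ 2 := by
      rw [hβ, sq (∑ j, b j ^ 2), Finset.sum_mul_sum]
      refine Finset.sum_congr rfl fun i _ => Finset.sum_congr rfl fun j _ => by ring
    have hCS : ∑ i : Fin n, ∑ j : Fin n, M i.succ j.succ * (b i * b j) ≤ K * β := by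
      have := Finset.sum_mul_sq_le_sq_mul_sq (Finset.univ : Finset (Fin n × Fin n))
        (fun p => M p.1.succ p.2.succ) (fun p => b p.1 * b p.2)
      simp only [Fintype.sum_prod_type] at this
      rw [hbb] at this
      apply abs_le_of_sq_le_sq' _ (by positivity) |>.2
      calc _ ≤ _ := this
        _ ≤ K ^ 2 * β ^ 2 := mul_le_mul_of_nonneg_right hPK (sq_nonneg _)
        _ = _ := by ring
    have hM'S : ∑ i, ∑ j, M' i j ^ 2 ≤ H' ^ 2 := by
      have : ∑ i, ∑ j, M' i j ^ 2 = P2 + 4 * t * (∑ i : Fin n, ∑ j : Fin n, M i.succ j.succ * (b i * b j))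
          + 4 * t ^ 2 * β ^ 2 := by
        rw [← hbb, hP2]
        simp only [Finset.mul_sum, ← Finset.sum_add_distrib]
        refine Finset.sum_congr rfl fun i _ => Finset.sum_congr rfl fun j _ => by
          simp only [hM']; ring
      rw [this]
      have h1 : 4 * t * (∑ i : Fin n, ∑ j : Fin n, M i.succ j.succ * (b i * b j)) ≤ 4 * t * (K * β) :=
        mul_le_mul_of_nonneg_left hCS (by positivity)
      have h2 : (K + 2 * t * β) ^ 2 ≤ H' ^ 2 := pow_le_pow_left₀ (by positivity) hKH 2
      nlinarith
    have key := ih M' hM's H' hH'0 hH'1 hM'S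
    rw [← (Fin.consEquiv (fun _ : Fin (n+1) => Bool)).sum_comp]
    rw [Fintype.sum_prod_type, Fintype.sum_bool, ← Finset.sum_add_distrib]
    have step : ∀ σ : Fin n → Bool,
        Real.exp (t * ((∑ i, ∑ j, sg (Fin.consEquiv (fun _ : Fin (n+1) => Bool) (true, σ) i) *
            sg (Fin.consEquiv (fun _ : Fin (n+1) => Bool) (true, σ) j) * M i j) - ∑ i, M i i)) +
        Real.exp (t * ((∑ i, ∑ j, sg (Fin.consEquiv (fun _ : Fin (n+1) => Bool) (false, σ) i) *
            sg (Fin.consEquiv (fun _ : Fin (n+1) => Bool) (false, σ) j) * M i j) - ∑ i, M i i))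
        ≤ 2 * Real.exp (2 * t ^ 2 * β) *
          Real.exp (t * ((∑ i, ∑ j, sg (σ i) * sg (σ j) * M' i j) - ∑ i, M' i i)) := by
      intro σ
      set x : ℝ := ∑ j, sg (σ j) * b j with hx
      set Q : ℝ := (∑ i : Fin n, ∑ j : Fin n, sg (σ i) * sg (σ j) * M i.succ j.succ) -
        ∑ i : Fin n, M i.succ i.succ with hQ
      have e1 : ∀ c : Bool, (∑ i, ∑ j, sg (Fin.consEquiv (fun _ : Fin (n+1) => Bool) (c, σ) i) *
            sg (Fin.consEquiv (fun _ : Fin (n+1) => Bool) (c, σ) j) * M i j) - ∑ i, M i i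
            = Q + 2 * sg c * x := by
        intro c
        simp only [Fin.sum_univ_succ, Fin.consEquiv_apply, Fin.cons_zero, Fin.cons_succ,
          Finset.sum_add_distrib, sg_sq]
        have h1 : ∑ i : Fin n, sg (σ i) * sg c * M i.succ 0 = sg c * x := by
          rw [hx, Finset.mul_sum]
          refine Finset.sum_congr rfl fun i _ => ?_
          rw [hM i.succ 0]; simp only [hb]; ring
        have h2 : ∑ i : Fin n, sg c * sg (σ i) * M 0 i.succ = sg c * x := by
          rw [hx, Finset.mul_sum]
          refine Finset.sum_congr rfl fun i _ => ?_
          simp only [hb]; ring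
        rw [h1, h2, hQ]; ring
      have e2 : (∑ i, ∑ j, sg (σ i) * sg (σ j) * M' i j) - ∑ i, M' i i
          = Q + 2 * t * x ^ 2 - 2 * t * β := by
        have h1 : ∑ i, ∑ j, sg (σ i) * sg (σ j) * M' i j =
            (∑ i : Fin n, ∑ j : Fin n, sg (σ i) * sg (σ j) * M i.succ j.succ) + 2 * t * x ^ 2 := by
          rw [hx, sq, Finset.sum_mul_sum]
          simp only [Finset.mul_sum, ← Finset.sum_add_distrib]
          refine Finset.sum_congr rfl fun i _ => Finset.sum_congr rfl fun j _ => by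
            simp only [hM']; ring
        have h2 : ∑ i, M' i i = (∑ i : Fin n, M i.succ i.succ) + 2 * t * β := by
          rw [hβ]
          simp only [Finset.mul_sum, ← Finset.sum_add_distrib]
          refine Finset.sum_congr rfl fun i _ => by
            simp only [hM']; ring
        rw [h1, h2, hQ]; ring
      rw [e1, e1, e2]
      have hc := Real.cosh_le_exp_half_sq (2 * t * x)
      rw [Real.cosh_eq] at hc
      have h3 : 2 * Real.exp (2 * t ^ 2 * β) * Real.exp (t * (Q + 2 * t * x ^ 2 - 2 * t * β))
          = Real.exp (t * Q) * (2 * Real.exp ((2 * t * x) ^ 2 / 2)) := by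
        rw [mul_assoc, ← Real.exp_add, mul_left_comm, ← Real.exp_add]; congr 2; ring
      rw [h3]
      have h4 : Real.exp (t * (Q + 2 * sg true * x)) + Real.exp (t * (Q + 2 * sg false * x))
         = Real.exp (t * Q) * (Real.exp (2 * t * x) + Real.exp (-(2 * t * x))) := by
        rw [mul_add (Real.exp _), ← Real.exp_add, ← Real.exp_add]
        simp only [sg, if_true, Bool.false_eq_true, if_false]
        congr 2 <;> ring
      rw [h4]
      exact mul_le_mul_of_nonneg_left (by linarith) (Real.exp_pos _).le
    calc _ ≤ ∑ σ : Fin n → Bool, 2 * Real.exp (2 * t ^ 2 * β) *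
          Real.exp (t * ((∑ i, ∑ j, sg (σ i) * sg (σ j) * M' i j) - ∑ i, M' i i)) :=
          Finset.sum_le_sum fun σ _ => step σ
      _ = 2 * Real.exp (2 * t ^ 2 * β) * ∑ σ : Fin n → Bool,
          Real.exp (t * ((∑ i, ∑ j, sg (σ i) * sg (σ j) * M' i j) - ∑ i, M' i i)) := by
          exact (Finset.mul_sum _ _ _).symm
      _ ≤ 2 * Real.exp (2 * t ^ 2 * β) * (2 ^ n * Real.exp (4 * t ^ 2 * H0 * H')) :=
          mul_le_mul_of_nonneg_left key (by positivity)
      _ = 2 ^ (n+1) * Real.exp (4 * t ^ 2 * H0 * H) := by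
          have : 4 * t ^ 2 * H0 * H = 2 * t ^ 2 * β + 4 * t ^ 2 * H0 * H' := by
            rw [hH']; field_simp; ring
          rw [this, Real.exp_add, pow_succ]; ring

lemma exists_isometry {V : Type} [NormedAddCommGroup V] [InnerProductSpace ℝ V]
    [FiniteDimensional ℝ V] {d : ℕ} (b0 : OrthonormalBasis (Fin d) ℝ V) (k : Fin d) (y : V)
    (hy : ‖y‖ = 1) : ∃ h : V ≃ₗᵢ[ℝ] V, h (b0 k) = y := by
  have hcard : Module.finrank ℝ V = Fintype.card (Fin d) :=
    Module.finrank_eq_card_basis b0.toBasis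
  have ho : Orthonormal ℝ (({k} : Set (Fin d)).domRestrict (fun _ => y)) := by
    constructor
    · intro i; exact hy
    · rintro ⟨i, hi⟩ ⟨j, hj⟩ hij
      exact absurd (Subtype.ext ((Set.mem_singleton_iff.1 hi).trans (Set.mem_singleton_iff.1 hj).symm)) hij
  obtain ⟨b, hb⟩ := ho.exists_orthonormalBasis_extension_of_card_eq hcard
  refine ⟨b0.repr.trans b.repr.symm, ?_⟩
  have := hb k (by simp)
  simp [this]

open MeasureTheory in
lemma haar_basis {V : Type} [NormedAddCommGroup V] [InnerProductSpace ℝ V]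
    [FiniteDimensional ℝ V] {d : ℕ} (hd : 0 < d) (b0 : OrthonormalBasis (Fin d) ℝ V)
    (F : V → ℝ) (hF : Continuous F) (C : ℝ)
    (h : ∀ b : OrthonormalBasis (Fin d) ℝ V,
      ∑ σ : Fin d → Bool, F ((Real.sqrt d)⁻¹ • ∑ j, sg (σ j) • b j) ≤ 2 ^ d * C) :
    ∃ b : OrthonormalBasis (Fin d) ℝ V, ∑ k, F (b k) ≤ d * C := by
  have : CompleteSpace V := FiniteDimensional.complete ℝ V
  have : ProperSpace (V →L[ℝ] V) := FiniteDimensional.proper ℝ _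
  let U := unitary (V →L[ℝ] V)
  have : CompactSpace U := by
    apply isCompact_iff_compactSpace.mp
    refine Metric.isCompact_of_isClosed_isBounded isClosed_unitary ?_
    refine (Metric.isBounded_closedBall (x := (0 : V →L[ℝ] V)) (r := 1)).subset ?_
    intro u hu
    simp only [Metric.mem_closedBall, dist_zero_right]
    refine ContinuousLinearMap.opNorm_le_bound _ zero_le_one fun x => ?_
    rw [one_mul]
    exact (Unitary.norm_map ⟨u, hu⟩ x).le
  let : MeasurableSpace U := borel U
  have : BorelSpace U := ⟨rfl⟩
  let K0 : TopologicalSpace.PositiveCompacts U := ⊤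
  let μ : Measure U := Measure.haarMeasure K0
  have : IsProbabilityMeasure μ := ⟨by
    have := Measure.haarMeasure_self (K₀ := K0)
    simpa [K0] using this⟩
  have hcont : ∀ y : V, Continuous fun g : U => F (((g⁻¹ : U) : V →L[ℝ] V) y) := by
    intro y
    refine hF.comp ?_
    have h1 : Continuous fun g : U => ((g⁻¹ : U) : V →L[ℝ] V) :=
      continuous_subtype_val.comp continuous_inv
    exact h1.clm_apply continuous_const
  have hIntegr : ∀ y : V, Integrable (fun g : U => F (((g⁻¹ : U) : V →L[ℝ] V) y)) μ := by
    intro y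
    exact (hcont y).integrable_of_hasCompactSupport (HasCompactSupport.of_compactSpace _)
  have hinv : ∀ (k : Fin d) (y : V), ‖y‖ = 1 →
      ∫ g : U, F (((g⁻¹ : U) : V →L[ℝ] V) (b0 k)) ∂μ = ∫ g : U, F (((g⁻¹ : U) : V →L[ℝ] V) y) ∂μ := by
    intro k y hy
    obtain ⟨e, he⟩ := exists_isometry b0 k y hy
    let u : U := Unitary.linearIsometryEquiv.symm e
    have hu : (u : V →L[ℝ] V) (b0 k) = y := he
    have := integral_mul_left_eq_self (μ := μ)
      (fun g : U => F (((g⁻¹ : U) : V →L[ℝ] V) y)) u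
    rw [← this]
    congr 1
    funext g
    have : ((u * g)⁻¹ : U) * u = g⁻¹ := by group
    rw [← this, ← hu]
    rfl
  have hy1 : ∀ σ : Fin d → Bool, ‖(Real.sqrt d)⁻¹ • ∑ j, sg (σ j) • b0 j‖ = 1 := by
    intro σ
    have h1 : ‖∑ j, sg (σ j) • b0 j‖ ^ 2 = d := by
      rw [← real_inner_self_eq_norm_sq, b0.orthonormal.inner_sum]
      simp [sg_sq]
    have h2 : ‖∑ j, sg (σ j) • b0 j‖ = Real.sqrt d := by
      rw [← h1, Real.sqrt_sq (norm_nonneg _)]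
    rw [norm_smul, h2, norm_inv, Real.norm_eq_abs, abs_of_nonneg (Real.sqrt_nonneg _)]
    have : (0:ℝ) < Real.sqrt d := Real.sqrt_pos.2 (by exact_mod_cast hd)
    field_simp
  have hk : ∀ k : Fin d, ∫ g : U, F (((g⁻¹ : U) : V →L[ℝ] V) (b0 k)) ∂μ ≤ C := by
    intro k
    have h1 : (2:ℝ) ^ d * ∫ g : U, F (((g⁻¹ : U) : V →L[ℝ] V) (b0 k)) ∂μ =
        ∫ g : U, ∑ σ : Fin d → Bool, F (((g⁻¹ : U) : V →L[ℝ] V)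
          ((Real.sqrt d)⁻¹ • ∑ j, sg (σ j) • b0 j)) ∂μ := by
      rw [integral_finsetSum _ (fun σ _ => hIntegr _)]
      rw [Finset.sum_congr rfl (fun σ _ => (hinv k _ (hy1 σ)).symm)]
      simp
    have h2 : ∫ g : U, ∑ σ : Fin d → Bool, F (((g⁻¹ : U) : V →L[ℝ] V)
          ((Real.sqrt d)⁻¹ • ∑ j, sg (σ j) • b0 j)) ∂μ ≤ ∫ g : U, 2 ^ d * C ∂μ := by
      refine integral_mono (integrable_finsetSum _ fun σ _ => hIntegr _) (integrable_const _) ?_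
      intro g
      have := h (b0.map (Unitary.linearIsometryEquiv g⁻¹))
      refine le_trans (le_of_eq ?_) this
      refine Finset.sum_congr rfl fun σ _ => ?_
      congr 1
      rw [map_smul, map_sum]
      congr 1
      refine Finset.sum_congr rfl fun j _ => ?_
      rw [map_smul]; rfl
    rw [← h1] at h2
    simp only [integral_const, probReal_univ, one_smul] at h2
    exact le_of_mul_le_mul_left h2 (by positivity)
  obtain ⟨g, hg⟩ := exists_le_integral (μ := μ)
    (integrable_finsetSum Finset.univ fun k _ => hIntegr (b0 k))
  refine ⟨b0.map (Unitary.linearIsometryEquiv g⁻¹), ?_⟩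
  calc _ = ∑ k, F (((g⁻¹ : U) : V →L[ℝ] V) (b0 k)) := rfl
    _ ≤ _ := hg
    _ = ∑ k, ∫ g : U, F (((g⁻¹ : U) : V →L[ℝ] V) (b0 k)) ∂μ :=
        integral_finsetSum _ (fun k _ => hIntegr _)
    _ ≤ ∑ k : Fin d, C := Finset.sum_le_sum fun k _ => hk k
    _ = d * C := by simp


noncomputable def lTr {G : Type} [Group G] [Fintype G] (h : G) :
    EuclideanSpace ℝ G ≃ₗᵢ[ℝ] EuclideanSpace ℝ G :=
  LinearIsometryEquiv.piLpCongrLeft 2 ℝ ℝ (Equiv.mulLeft h)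

lemma lTr_apply {G : Type} [Group G] [Fintype G] (h : G) (f : EuclideanSpace ℝ G) (g : G) :
    lTr h f g = f (h⁻¹ * g) := by
  simp [lTr, LinearIsometryEquiv.piLpCongrLeft_apply, Equiv.piCongrLeft'_apply]

lemma lTr_symm_apply {G : Type} [Group G] [Fintype G] (h : G) (f : EuclideanSpace ℝ G) (g : G) :
    (lTr h).symm f g = f (h * g) := by
  have := lTr_apply h ((lTr h).symm f) (h * g)
  simp at this
  exact this.symm

lemma proj_norm {G : Type} [Group G] [Fintype G] [DecidableEq G]
    (V : Submodule ℝ (EuclideanSpace ℝ G)) (hV : ∀ h : G, ∀ v ∈ V, lTr h v ∈ V) {d : ℕ}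
    (b : OrthonormalBasis (Fin d) ℝ V) (g : G) :
    ∑ j, (b j : EuclideanSpace ℝ G) g ^ 2 = ‖V.starProjection (EuclideanSpace.single g 1)‖ ^ 2 := by
  have h1 := b.sum_sq_norm_inner_right (V.orthogonalProjectionOnto (EuclideanSpace.single g 1))
  have h0 : ‖V.starProjection (EuclideanSpace.single g 1)‖ =
    ‖V.orthogonalProjectionOnto (EuclideanSpace.single g (1:ℝ))‖ := rfl
  rw [h0, ← h1]
  refine Finset.sum_congr rfl fun j _ => ?_
  rw [Submodule.inner_orthogonalProjectionOnto_eq_of_mem_left, EuclideanSpace.inner_single_right]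
  simp

lemma diag_const {G : Type} [Group G] [Fintype G]
    (V : Submodule ℝ (EuclideanSpace ℝ G)) (hV : ∀ h : G, ∀ v ∈ V, lTr h v ∈ V) {d : ℕ}
    (b : OrthonormalBasis (Fin d) ℝ V) (g : G) :
    ∑ j, (b j : EuclideanSpace ℝ G) g ^ 2 = d / Fintype.card G := by
  classical
  have hmap : ∀ h : G, V.map ((lTr h).toLinearEquiv : EuclideanSpace ℝ G →ₗ[ℝ] EuclideanSpace ℝ G) = V := by
    intro h
    apply Submodule.eq_of_le_of_finrank_eq
    · rintro _ ⟨v, hv, rfl⟩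
      exact hV h v hv
    · exact LinearEquiv.finrank_map_eq _ _
  have hinv : ∀ g : G, ∑ j, (b j : EuclideanSpace ℝ G) g ^ 2
      = ∑ j, (b j : EuclideanSpace ℝ G) 1 ^ 2 := by
    intro g
    rw [proj_norm V hV, proj_norm V hV]
    have h1 := Submodule.starProjection_map_apply (lTr g) V (EuclideanSpace.single g 1)
    have h2 : (lTr g).symm (EuclideanSpace.single g (1:ℝ)) = EuclideanSpace.single 1 1 := by
      ext x
      rw [lTr_symm_apply]
      simp
    simp only [hmap] at h1
    rw [h1, h2, LinearIsometryEquiv.norm_map]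
  have hsum : ∑ g : G, ∑ j, (b j : EuclideanSpace ℝ G) g ^ 2 = d := by
    rw [Finset.sum_comm]
    have : ∀ j, ∑ g : G, (b j : EuclideanSpace ℝ G) g ^ 2 = 1 := by
      intro j
      have h1 : ‖(b j : EuclideanSpace ℝ G)‖ = 1 := b.orthonormal.1 j
      have h2 := EuclideanSpace.real_norm_sq_eq (b j : EuclideanSpace ℝ G)
      rw [← h2, h1]; norm_num
    simp [this]
  rw [Finset.sum_congr rfl (fun g _ => hinv g)] at hsum
  rw [hinv g]
  have hN : (Fintype.card G : ℝ) ≠ 0 := by exact_mod_cast Fintype.card_ne_zero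
  simp at hsum
  field_simp
  linarith

lemma M_trace {G : Type} [Group G] [Fintype G]
    (V : Submodule ℝ (EuclideanSpace ℝ G)) (hV : ∀ h : G, ∀ v ∈ V, lTr h v ∈ V) {d : ℕ}
    (b : OrthonormalBasis (Fin d) ℝ V) (A : Finset G) :
    ∑ j, ∑ g ∈ A, (b j : EuclideanSpace ℝ G) g * (b j : EuclideanSpace ℝ G) g
      = d * A.card / Fintype.card G := by
  rw [Finset.sum_comm]
  rw [Finset.sum_congr rfl (g := fun _ => (d : ℝ) / Fintype.card G)]
  · simp; ring
  · intro g _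
    rw [← diag_const V hV b g]
    refine Finset.sum_congr rfl fun j _ => by ring

lemma M_HS {G : Type} [Group G] [Fintype G]
    (V : Submodule ℝ (EuclideanSpace ℝ G)) (hV : ∀ h : G, ∀ v ∈ V, lTr h v ∈ V) {d : ℕ}
    (b : OrthonormalBasis (Fin d) ℝ V) (A : Finset G) :
    ∑ j, ∑ l, (∑ g ∈ A, (b j : EuclideanSpace ℝ G) g * (b l : EuclideanSpace ℝ G) g) ^ 2
      ≤ d * A.card / Fintype.card G := by
  classical
  rw [← M_trace V hV b A]
  refine Finset.sum_le_sum fun j _ => ?_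
  let w : EuclideanSpace ℝ G := WithLp.toLp 2 fun g => if g ∈ A then (b j : EuclideanSpace ℝ G) g else 0
  have ho : Orthonormal ℝ (fun l => (b l : EuclideanSpace ℝ G)) :=
    b.orthonormal.comp_linearIsometry V.subtypeₗᵢ
  have h1 := ho.sum_inner_products_le (x := w) (s := Finset.univ)
  have h2 : ‖w‖ ^ 2 = ∑ g ∈ A, (b j : EuclideanSpace ℝ G) g * (b j : EuclideanSpace ℝ G) g := by
    rw [EuclideanSpace.real_norm_sq_eq]
    simp [w, ite_pow, Finset.sum_ite_mem, sq]
  rw [h2] at h1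
  refine le_trans (le_of_eq ?_) h1
  refine Finset.sum_congr rfl fun l _ => ?_
  rw [Real.norm_eq_abs, sq_abs]
  congr 1
  simp [w, PiLp.inner_apply, Finset.sum_ite_mem]

def LC {G : Type} [Group G] : Representation ℂ G (G → ℂ) where
  toFun h := { toFun := fun f g => f (h⁻¹ * g), map_add' := fun _ _ => rfl, map_smul' := fun _ _ => rfl }
  map_one' := by ext f g; simp
  map_mul' h k := by ext f g; simp [mul_assoc]

lemma LC_apply {G : Type} [Group G] (h : G) (f : G → ℂ) (g : G) : LC h f g = f (h⁻¹ * g) := rfl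

lemma exists_irrep {G : Type} [Group G] [Fintype G] (U : Submodule ℂ (G → ℂ)) (hU0 : U ≠ ⊥)
    (hU : ∀ h : G, ∀ u ∈ U, LC h u ∈ U) (hUs : ∀ u ∈ U, ∑ g, u g = 0) :
    ∃ R : NontrivIrrep G, Module.finrank ℂ R.W ≤ Module.finrank ℂ U := by
  obtain ⟨W, ⟨hWU, hW0, hW⟩, hmin⟩ := (wellFounded_lt (α := Submodule ℂ (G → ℂ))).has_min
    {W | W ≤ U ∧ W ≠ ⊥ ∧ ∀ h : G, ∀ u ∈ W, LC h u ∈ W} ⟨U, le_rfl, hU0, hU⟩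
  refine ⟨{ W := W
            ρ := { toFun := fun h => (LC h).restrict (hW h)
                   map_one' := by ext x; simp
                   map_mul' := fun h k => by ext x; simp }
            irr := ?_
            nontriv := ?_ }, Submodule.finrank_mono hWU⟩
  · intro X hX
    by_cases hX0 : X = ⊥
    · exact Or.inl hX0
    right
    have hle : X.map W.subtype ≤ W := Submodule.map_subtype_le W X
    have hmem : X.map W.subtype ∈ {W | W ≤ U ∧ W ≠ ⊥ ∧ ∀ h : G, ∀ u ∈ W, LC h u ∈ W} := by
      refine ⟨hle.trans hWU, ?_, ?_⟩
      · intro h0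
        apply hX0
        apply Submodule.map_injective_of_injective W.injective_subtype
        rw [h0, Submodule.map_bot]
      · rintro h _ ⟨x, hx, rfl⟩
        exact ⟨_, hX h x hx, rfl⟩
    have heq : X.map W.subtype = W := by
      by_contra hne
      exact hmin _ hmem (lt_of_le_of_ne hle hne)
    apply Submodule.map_injective_of_injective W.injective_subtype
    rw [heq, Submodule.map_top, Submodule.range_subtype]
  · by_contra hcon
    push Not at hcon
    apply hW0
    rw [Submodule.eq_bot_iff]
    intro x hx
    have h1 : ∀ h : G, LC h x = x := fun h => by
      have := congrArg (fun T => ((T ⟨x, hx⟩ : W) : G → ℂ)) (hcon h)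
      exact this
    have h2 : ∀ g : G, x g = x 1 := by
      intro g
      have := congrFun (h1 g) g
      rw [LC_apply] at this
      simpa using this.symm
    have h3 := hUs x (hWU hx)
    rw [Finset.sum_congr rfl (fun g _ => h2 g)] at h3
    simp at h3
    ext g
    rw [h2 g, h3]; rfl

lemma exists_irrep_of_nonconst {G : Type} [Group G] [Fintype G]
    (V : Submodule ℝ (EuclideanSpace ℝ G)) (hV : ∀ h : G, ∀ v ∈ V, lTr h v ∈ V)
    (v : EuclideanSpace ℝ G) (hv : v ∈ V) (g0 : G) (hg0 : v g0 ≠ v 1) :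
    ∃ R : NontrivIrrep G, Module.finrank ℂ R.W ≤ Module.finrank ℝ V := by
  let sm : EuclideanSpace ℝ G →ₗ[ℝ] ℝ :=
    { toFun := fun f => ∑ g, f g
      map_add' := fun f f' => by simp [Finset.sum_add_distrib]
      map_smul' := fun r f => by simp [Finset.mul_sum] }
  have hsm : ∀ f, sm f = ∑ g, f g := fun _ => rfl
  have hsmL : ∀ h f, sm (lTr h f) = sm f := by
    intro h f
    simp only [hsm, lTr_apply]
    exact Equiv.sum_comp (Equiv.mulLeft h⁻¹) (fun g => f g)
  let V' : Submodule ℝ (EuclideanSpace ℝ G) := V ⊓ LinearMap.ker sm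
  have hV' : ∀ h : G, ∀ v ∈ V', lTr h v ∈ V' := by
    rintro h u ⟨hu1, hu2⟩
    refine ⟨hV h u hu1, ?_⟩
    show sm (lTr h u) = 0
    rw [hsmL]; exact hu2
  let ι : EuclideanSpace ℝ G →ₗ[ℝ] (G → ℂ) :=
    { toFun := fun f g => (f g : ℂ)
      map_add' := fun f f' => by ext g; simp
      map_smul' := fun r f => by ext g; simp }
  have hι : ∀ f g, ι f g = (f g : ℂ) := fun _ _ => rfl
  let bs := Module.finBasis ℝ V'
  let U : Submodule ℂ (G → ℂ) := Submodule.span ℂ (Set.range fun j => ι (bs j))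
  have hιU : ∀ u ∈ V', ι u ∈ U := by
    intro u hu
    have h1 := bs.sum_repr ⟨u, hu⟩
    have h2 : u = ∑ j, bs.repr ⟨u, hu⟩ j • (bs j : EuclideanSpace ℝ G) := by
      have := congrArg (fun x : V' => (x : EuclideanSpace ℝ G)) h1
      simp only [Submodule.coe_sum, Submodule.coe_smul] at this
      exact this.symm
    rw [h2, map_sum]
    refine Submodule.sum_mem _ fun j _ => ?_
    rw [map_smul]
    have : bs.repr ⟨u, hu⟩ j • ι (bs j) = ((bs.repr ⟨u, hu⟩ j : ℝ) : ℂ) • ι (bs j) := by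
      ext g; simp
    rw [this]
    exact Submodule.smul_mem _ _ (Submodule.subset_span ⟨j, rfl⟩)
  have hUinv : ∀ h : G, ∀ u ∈ U, LC h u ∈ U := by
    intro h u hu
    have : U ≤ U.comap (LC h) := by
      apply Submodule.span_le.2
      rintro _ ⟨j, rfl⟩
      show LC h (ι (bs j)) ∈ U
      have h1 : LC h (ι (bs j)) = ι (lTr h (bs j)) := by
        ext g; rw [LC_apply, hι, hι, lTr_apply]
      rw [h1]
      exact hιU _ (hV' h _ (bs j).2)
    exact this hu
  have hUs : ∀ u ∈ U, ∑ g, u g = 0 := by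
    intro u hu
    induction hu using Submodule.span_induction with
    | mem x hx =>
      obtain ⟨j, rfl⟩ := hx
      have : sm (bs j) = 0 := (bs j).2.2
      rw [hsm] at this
      simp only [hι]
      exact_mod_cast this
    | zero => simp
    | add x y _ _ hx hy => simp [Finset.sum_add_distrib, hx, hy]
    | smul a x _ hx => simp [← Finset.mul_sum, hx]
  have hU0 : U ≠ ⊥ := by
    intro h0
    have hw : lTr g0⁻¹ v - v ∈ V' := by
      refine ⟨V.sub_mem (hV _ _ hv) hv, ?_⟩
      show sm _ = 0
      rw [map_sub, hsmL, sub_self]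
    have := hιU _ hw
    rw [h0, Submodule.mem_bot] at this
    have h1 := congrFun this 1
    rw [hι] at h1
    have h2 : (lTr g0⁻¹ v - v) 1 = 0 := Complex.ofReal_eq_zero.1 h1
    have h3 : (lTr g0⁻¹ v - v) 1 = v g0 - v 1 := by
      rw [PiLp.sub_apply, lTr_apply]; simp
    rw [h3] at h2
    exact hg0 (sub_eq_zero.1 h2)
  obtain ⟨R, hR⟩ := exists_irrep U hU0 hUinv hUs
  refine ⟨R, hR.trans ?_⟩
  have h1 : Module.finrank ℂ U ≤ Fintype.card (Fin (Module.finrank ℝ V')) :=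
    finrank_range_le_card _
  rw [Fintype.card_fin] at h1
  exact h1.trans (Submodule.finrank_mono inf_le_left)

lemma good_basis {G : Type} [Group G] [Fintype G]
    (V : Submodule ℝ (EuclideanSpace ℝ G)) (hV : ∀ h : G, ∀ v ∈ V, lTr h v ∈ V) {d : ℕ}
    (hd : 0 < d) (hdN : d ≤ Fintype.card G)
    (b0 : OrthonormalBasis (Fin d) ℝ V) (hN : 2 ≤ Fintype.card G) (m : ℕ)
    (hm : m ≤ Fintype.card G) (A : Fin m → Finset G) (hA : ∀ i, 0 < (A i).card) (δ : Fin m → ℝ)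
    (hδ : ∀ i, 128 * Real.log (Fintype.card G) * Real.sqrt (d * (A i).card / Fintype.card G)
      ≤ d * δ i) :
    ∃ b : OrthonormalBasis (Fin d) ℝ V, ∀ i k,
      |(∑ g ∈ A i, (b k : EuclideanSpace ℝ G) g ^ 2) - ((A i).card : ℝ) / Fintype.card G| ≤ δ i := by
  have hN2 : (2 : ℝ) ≤ Fintype.card G := by exact_mod_cast hN
  have hd' : (0 : ℝ) < d := by exact_mod_cast hd
  set N : ℝ := (Fintype.card G : ℝ) with hNdef
  set τ : Fin m → ℝ := fun i => d * (A i).card / N with hτ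
  have hτ0 : ∀ i, 0 < τ i := by
    intro i
    have : (0 : ℝ) < (A i).card := by exact_mod_cast hA i
    simp only [hτ]; positivity
  set t : Fin m → ℝ := fun i => 1 / (4 * Real.sqrt (τ i)) with ht
  have hsq : ∀ i, 0 < Real.sqrt (τ i) := fun i => Real.sqrt_pos.2 (hτ0 i)
  have ht0 : ∀ i, 0 < t i := fun i => by have := hsq i; simp only [ht]; positivity
  set X : Fin m → V → ℝ := fun i v =>
    (∑ g ∈ A i, (v : EuclideanSpace ℝ G) g ^ 2) - ((A i).card : ℝ) / N with hX
  have hXc : ∀ i, Continuous (X i) := by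
    intro i
    simp only [hX]
    fun_prop
  set F : V → ℝ := fun v => ∑ i, (Real.exp (t i * (d * X i v)) + Real.exp (t i * (-(d * X i v))))
    with hF
  have hFc : Continuous F := by
    simp only [hF]
    refine continuous_finsetSum _ fun i _ => ?_
    have := hXc i
    fun_prop
  have hbound : ∀ b : OrthonormalBasis (Fin d) ℝ V,
      ∑ σ : Fin d → Bool, F ((Real.sqrt d)⁻¹ • ∑ j, sg (σ j) • b j)
        ≤ 2 ^ d * (m * (2 * Real.exp (1 / 4))) := by
    intro b
    simp only [hF]
    rw [Finset.sum_comm]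
    have each : ∀ i, ∑ σ : Fin d → Bool,
        (Real.exp (t i * (d * X i ((Real.sqrt d)⁻¹ • ∑ j, sg (σ j) • b j))) +
          Real.exp (t i * (-(d * X i ((Real.sqrt d)⁻¹ • ∑ j, sg (σ j) • b j)))))
        ≤ 2 ^ d * (2 * Real.exp (1 / 4)) := by
      intro i
      set M : Fin d → Fin d → ℝ := fun j l =>
        ∑ g ∈ A i, (b j : EuclideanSpace ℝ G) g * (b l : EuclideanSpace ℝ G) g with hM
      have hMtr : ∑ j, M j j = τ i := M_trace V hV b (A i)
      have hMHS : ∑ j, ∑ l, M j l ^ 2 ≤ τ i := M_HS V hV b (A i)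
      have hMs : ∀ j l, M j l = M l j := fun j l => by
        simp only [hM]; exact Finset.sum_congr rfl fun g _ => mul_comm _ _
      have hdX : ∀ σ : Fin d → Bool, d * X i ((Real.sqrt d)⁻¹ • ∑ j, sg (σ j) • b j)
          = (∑ j, ∑ l, sg (σ j) * sg (σ l) * M j l) - ∑ j, M j j := by
        intro σ
        rw [hMtr]
        simp only [hX, hτ, mul_sub]
        congr 1
        · have h1 : ∀ g : G, (((Real.sqrt d)⁻¹ • ∑ j, sg (σ j) • b j : V) : EuclideanSpace ℝ G) g
              = (Real.sqrt d)⁻¹ * ∑ j, sg (σ j) * (b j : EuclideanSpace ℝ G) g := by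
            intro g
            simp
          have h2 : ∀ g : G, (d : ℝ) * ((Real.sqrt d)⁻¹ * ∑ j, sg (σ j) * (b j : EuclideanSpace ℝ G) g) ^ 2
              = ∑ j, ∑ l, sg (σ j) * sg (σ l) *
                ((b j : EuclideanSpace ℝ G) g * (b l : EuclideanSpace ℝ G) g) := by
            intro g
            rw [mul_pow, inv_pow, Real.sq_sqrt hd'.le, mul_inv_cancel_left₀ hd'.ne', sq,
              Finset.sum_mul_sum]
            exact Finset.sum_congr rfl fun j _ => Finset.sum_congr rfl fun l _ => by ring
          simp only [h1]
          rw [Finset.mul_sum, Finset.sum_congr rfl fun g _ => h2 g, Finset.sum_comm]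
          refine Finset.sum_congr rfl fun j _ => ?_
          rw [Finset.sum_comm]
          refine Finset.sum_congr rfl fun l _ => ?_
          simp only [hM]
          rw [Finset.mul_sum]
        · ring
      have htH : 4 * t i * Real.sqrt (τ i) ≤ 1 := by
        have := hsq i
        simp only [ht]
        apply le_of_eq; field_simp
      have hexp : 4 * t i ^ 2 * Real.sqrt (τ i) * Real.sqrt (τ i) = 1 / 4 := by
        have := hsq i
        simp only [ht]
        field_simp
        try norm_num
      have c1 := chaos (t i) (Real.sqrt (τ i)) (ht0 i).le (hsq i) htH d M hMs (Real.sqrt (τ i))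
        (hsq i).le le_rfl (by rw [Real.sq_sqrt (hτ0 i).le]; exact hMHS)
      have c2 := chaos (t i) (Real.sqrt (τ i)) (ht0 i).le (hsq i) htH d (fun j l => - M j l)
        (fun j l => by rw [hMs]) (Real.sqrt (τ i))
        (hsq i).le le_rfl (by rw [Real.sq_sqrt (hτ0 i).le]; simpa using hMHS)
      rw [hexp] at c1 c2
      rw [Finset.sum_add_distrib]
      simp only [hdX]
      have e2 : ∀ σ : Fin d → Bool, (∑ j, ∑ l, sg (σ j) * sg (σ l) * -M j l) - ∑ j, -M j j
        = -((∑ j, ∑ l, sg (σ j) * sg (σ l) * M j l) - ∑ j, M j j) := by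
        intro σ
        simp only [mul_neg, Finset.sum_neg_distrib]; ring
      simp only [e2] at c2
      linarith
    calc _ ≤ ∑ i : Fin m, (2:ℝ) ^ d * (2 * Real.exp (1 / 4)) := Finset.sum_le_sum fun i _ => each i
      _ = _ := by simp; ring
  obtain ⟨b, hb⟩ := haar_basis hd b0 F hFc _ hbound
  refine ⟨b, fun i k => ?_⟩
  by_contra hcon
  push Not at hcon
  change δ i < |X i (b k)| at hcon
  have h1 : 32 * Real.log N ≤ t i * (d * |X i (b k)|) := by
    have h2 : t i * (d * δ i) ≤ t i * (d * |X i (b k)|) := by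
      have := ht0 i
      gcongr
    have h3 : t i * (128 * Real.log N * Real.sqrt (τ i)) ≤ t i * (d * δ i) :=
      mul_le_mul_of_nonneg_left (hδ i) (ht0 i).le
    have h4 : t i * (128 * Real.log N * Real.sqrt (τ i)) = 32 * Real.log N := by
      have := hsq i
      simp only [ht]; field_simp; ring
    linarith
  have h5 : N ^ 32 ≤ Real.exp (t i * (d * |X i (b k)|)) := by
    calc N ^ 32 = Real.exp (32 * Real.log N) := by
          rw [show (32 : ℝ) * Real.log N = ((32 : ℕ) : ℝ) * Real.log N by norm_num,
            Real.exp_nat_mul, Real.exp_log (by linarith)]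
      _ ≤ _ := Real.exp_le_exp.2 h1
  have h6 : Real.exp (t i * (d * |X i (b k)|)) ≤
      Real.exp (t i * (d * X i (b k))) + Real.exp (t i * (-(d * X i (b k)))) := by
    rcases abs_choice (X i (b k)) with h | h <;> rw [h]
    · have := Real.exp_pos (t i * (-(d * X i (b k)))); linarith
    · rw [mul_neg (d : ℝ)]
      have := Real.exp_pos (t i * (d * X i (b k))); linarith
  have hnn : ∀ v i, 0 ≤ Real.exp (t i * (d * X i v)) + Real.exp (t i * (-(d * X i v))) :=
    fun v i => by positivity
  have h7 : Real.exp (t i * (d * X i (b k))) + Real.exp (t i * (-(d * X i (b k)))) ≤ F (b k) :=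
    Finset.single_le_sum (f := fun i => Real.exp (t i * (d * X i (b k))) + Real.exp (t i * (-(d * X i (b k)))))
      (fun i _ => hnn _ i) (Finset.mem_univ i)
  have h8 : F (b k) ≤ ∑ k, F (b k) :=
    Finset.single_le_sum (f := fun k => F (b k))
      (fun k _ => Finset.sum_nonneg fun i _ => hnn _ i) (Finset.mem_univ k)
  have h9 : (d : ℝ) * (m * (2 * Real.exp (1 / 4))) ≤ N * (N * 6) := by
    have e1 : Real.exp (1 / 4) ≤ 3 := by
      have := Real.exp_one_lt_d9
      have h := Real.exp_le_exp.2 (show (1 / 4 : ℝ) ≤ 1 by norm_num)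
      linarith
    have e2 : (d : ℝ) ≤ N := by rw [hNdef]; exact_mod_cast hdN
    have e3 : (m : ℝ) ≤ N := by rw [hNdef]; exact_mod_cast hm
    gcongr
    linarith
  have h10 : N ^ 5 ≤ N ^ 32 := pow_le_pow_right₀ (by linarith) (by norm_num)
  have h11 : N * (N * 6) < N ^ 5 := by
    have : (2:ℝ) ^ 3 ≤ N ^ 3 := pow_le_pow_left₀ (by norm_num) hN2 3
    have h2 : 0 < N * N := by positivity
    nlinarith
  linarith

lemma const_norm {G : Type} [Group G] [Fintype G] (v : EuclideanSpace ℝ G) (hv : ‖v‖ = 1)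
    (h : ∀ g, v g = v 1) (A : Finset G) :
    ∑ g ∈ A, v g ^ 2 = (A.card : ℝ) / Fintype.card G := by
  have h1 := EuclideanSpace.real_norm_sq_eq v
  have hN : (Fintype.card G : ℝ) ≠ 0 := by exact_mod_cast Fintype.card_ne_zero
  rw [hv, Finset.sum_congr rfl (fun g _ => by rw [h g])] at h1
  rw [Finset.sum_congr rfl (fun g _ => by rw [h g])]
  simp at h1 ⊢
  field_simp
  rw [mul_assoc, mul_comm (v.ofLp 1 ^ 2), ← h1, mul_one]

noncomputable def adjT {G : Type} [Group G] [Fintype G] (S : Finset G) :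
    EuclideanSpace ℝ G →ₗ[ℝ] EuclideanSpace ℝ G where
  toFun f := WithLp.toLp 2 fun g => ∑ x ∈ S, f (g * x)
  map_add' f f' := by ext g; simp [Finset.sum_add_distrib]
  map_smul' r f := by ext g; simp [Finset.mul_sum]

lemma adjT_apply {G : Type} [Group G] [Fintype G] (S : Finset G) (f : EuclideanSpace ℝ G) (g : G) :
    adjT S f g = ∑ x ∈ S, f (g * x) := rfl

lemma adjT_symm {G : Type} [Group G] [Fintype G] (S : Finset G) (hS : ∀ x ∈ S, x⁻¹ ∈ S) :
    (adjT S).IsSymmetric := by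
  intro f f'
  simp only [PiLp.inner_apply, adjT_apply, RCLike.inner_apply, conj_trivial, Finset.mul_sum,
    Finset.sum_mul]
  rw [Finset.sum_comm, Finset.sum_comm (s := Finset.univ) (t := S)]
  refine Finset.sum_nbij' (fun x => x⁻¹) (fun x => x⁻¹) hS hS (by simp) (by simp) ?_
  intro x _
  rw [← Equiv.sum_comp (Equiv.mulRight x⁻¹)]
  simp

lemma exists_real_basis {G : Type} [Group G] [Fintype G] (S : Finset G) (hS : ∀ x ∈ S, x⁻¹ ∈ S)
    (D : ℕ) (hD : ∀ R : NontrivIrrep G, D ≤ Module.finrank ℂ R.W)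
    (hN : 2 ≤ Fintype.card G) (m : ℕ) (A : Fin m → Finset G) (hm : m ≤ Fintype.card G)
    (hA : ∀ i, 0 < (A i).card) (δ : Fin m → ℝ) (hδ0 : ∀ i, 0 ≤ δ i)
    (hδ : ∀ d : ℕ, D ≤ d → ∀ i,
      128 * Real.log (Fintype.card G) * Real.sqrt (d * (A i).card / Fintype.card G) ≤ d * δ i) :
    ∃ B : OrthonormalBasis G ℝ (EuclideanSpace ℝ G),
      (∀ φ, ∃ μ : ℝ, ∀ g : G, ∑ x ∈ S, B φ (g * x) = μ * B φ g) ∧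
      ∀ i φ, |(∑ g ∈ A i, B φ g ^ 2) - ((A i).card : ℝ) / Fintype.card G| ≤ δ i := by
  classical
  set T := adjT S with hTdef
  have hT : T.IsSymmetric := adjT_symm S hS
  have hinv : ∀ μ : ℝ, ∀ h : G, ∀ v ∈ Module.End.eigenspace T μ, lTr h v ∈ Module.End.eigenspace T μ := by
    intro μ h v hv
    rw [Module.End.mem_eigenspace_iff] at hv ⊢
    ext g
    have := congrArg (fun f : EuclideanSpace ℝ G => f (h⁻¹ * g)) hv
    simp only [hTdef, adjT_apply, PiLp.smul_apply, lTr_apply, mul_assoc] at this ⊢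
    exact this
  have hex : ∀ μ : Module.End.Eigenvalues T,
      ∃ b : OrthonormalBasis (Fin (Module.finrank ℝ (Module.End.eigenspace T (μ : ℝ)))) ℝ
        (Module.End.eigenspace T (μ : ℝ)), ∀ i k,
      |(∑ g ∈ A i, (b k : EuclideanSpace ℝ G) g ^ 2) - ((A i).card : ℝ) / Fintype.card G| ≤ δ i := by
    intro μ
    set V := Module.End.eigenspace T (μ : ℝ) with hVdef
    by_cases hc : ∃ v ∈ V, ∃ g, v g ≠ v 1
    · obtain ⟨v, hv, g0, hg0⟩ := hc
      obtain ⟨R, hR⟩ := exists_irrep_of_nonconst V (hinv μ) v hv g0 hg0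
      have hd : 0 < Module.finrank ℝ V := by
        apply Module.finrank_pos_iff_exists_ne_zero.2
        refine ⟨⟨v, hv⟩, fun h0 => hg0 ?_⟩
        have : v = 0 := congrArg Subtype.val h0
        simp [this]
      refine good_basis V (hinv μ) hd ?_ (stdOrthonormalBasis ℝ V) hN m hm A hA δ
        (hδ _ ((hD R).trans hR))
      exact (Submodule.finrank_le V).trans (by simp)
    · push Not at hc
      refine ⟨stdOrthonormalBasis ℝ V, fun i k => ?_⟩
      have hn : ‖(((stdOrthonormalBasis ℝ V) k : V) : EuclideanSpace ℝ G)‖ = 1 :=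
        (stdOrthonormalBasis ℝ V).orthonormal.1 k
      rw [const_norm _ hn (hc _ (Subtype.mem _))]
      simpa using hδ0 i
  choose b hb using hex
  have hI := hT.direct_sum_isInternal
  have hO := hT.orthogonalFamily_eigenspaces'
  let B0 := hI.collectedOrthonormalBasis hO b
  have hcard : Fintype.card (Σ μ : Module.End.Eigenvalues T,
      Fin (Module.finrank ℝ (Module.End.eigenspace T (μ : ℝ)))) = Fintype.card G := by
    rw [← Module.finrank_eq_card_basis B0.toBasis]; simp
  let e := Fintype.equivOfCardEq hcard
  refine ⟨B0.reindex e, fun φ => ?_, fun i φ => ?_⟩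
  · rw [B0.reindex_apply]
    have := hI.collectedOrthonormalBasis_mem hO b (e.symm φ)
    rw [Module.End.mem_eigenspace_iff] at this
    refine ⟨(e.symm φ).1, fun g => ?_⟩
    exact congrArg (fun f : EuclideanSpace ℝ G => f g) this
  · rw [B0.reindex_apply]
    have h1 : B0 (e.symm φ) = b (e.symm φ).1 (e.symm φ).2 := by
      simp [B0, DirectSum.IsInternal.collectedOrthonormalBasis]
    rw [h1]
    exact hb _ i _

lemma exists_complex_basis {G : Type} [Fintype G]
    (B : OrthonormalBasis G ℝ (EuclideanSpace ℝ G)) :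
    ∃ B' : OrthonormalBasis G ℂ (EuclideanSpace ℂ G), ∀ φ g, B' φ g = (B φ g : ℂ) := by
  classical
  let v : G → EuclideanSpace ℂ G := fun φ => WithLp.toLp 2 fun g => (B φ g : ℂ)
  have ho : Orthonormal ℂ v := by
    rw [orthonormal_iff_ite]
    intro i j
    have h1 := orthonormal_iff_ite.1 B.orthonormal i j
    simp only [PiLp.inner_apply, RCLike.inner_apply, conj_trivial] at h1
    simp only [PiLp.inner_apply, RCLike.inner_apply, v, Complex.conj_ofReal]
    rw [← Complex.ofReal_one, ← Complex.ofReal_zero, ← apply_ite Complex.ofReal, ← h1]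
    push_cast
    rfl
  obtain ⟨B', hB'⟩ := Orthonormal.exists_orthonormalBasis_extension_of_card_eq
    (v := v) (s := Set.univ) (𝕜 := ℂ) (by simp) (ho.comp _ Subtype.val_injective)
  exact ⟨B', fun φ g => by rw [hB' φ (Set.mem_univ _)]⟩

theorem stmt_3 (c η : ℝ) (hc : 0 < c) (hη : 0 < η) :
    ∃ N₀ : ℕ, ∀ (s ε C : ℝ), 0 < s → 0 < ε → ε < s → η = s - ε → 0 < C →
      ∀ (G : Type) [Group G] [Fintype G],
        ∀ D : ℕ,
          (∀ R : NontrivIrrep G, D ≤ Module.finrank ℂ R.W) →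
          (∃ R : NontrivIrrep G, Module.finrank ℂ R.W = D) →
          ((Fintype.card G : ℝ) ^ s ≤ (D : ℝ)) →
          N₀ ≤ Fintype.card G →
          ∀ (S : Finset G), (∀ x ∈ S, x⁻¹ ∈ S) →
            ∀ (m : ℕ) (A : Fin m → Finset G),
              (∀ g : G, ∃! i : Fin m, g ∈ A i) →
              (∀ i, c * (Fintype.card G : ℝ) ^ (1 - η) ≤ ((A i).card : ℝ) ∧
                ((A i).card : ℝ) ≤ C * (Fintype.card G : ℝ) ^ (1 - η)) →
              ∃ B : OrthonormalBasis G ℂ (EuclideanSpace ℂ G),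
                (∀ φ : G, (∀ g : G, (B φ g).im = 0) ∧
                  ∃ μ : ℂ, ∀ g : G, ∑ x ∈ S, B φ (g * x) = μ * B φ g) ∧
                (∀ (i : Fin m) (φ : G),
                  |(∑ g ∈ A i, ‖B φ g‖ ^ 2) - ((A i).card : ℝ) / (Fintype.card G : ℝ)| ≤
                    128 / Real.sqrt c * Real.log (Fintype.card G) /
                      (Fintype.card G : ℝ) ^ (ε / 2) *
                      (((A i).card : ℝ) / (Fintype.card G : ℝ))) := by
  refine ⟨2, ?_⟩
  intro s ε C _ hε _ hηs _ G _ _ D hD _ hsD hN S hS m A hpart hA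
  have hN2 : (2 : ℝ) ≤ Fintype.card G := by exact_mod_cast hN
  have hN0 : (0 : ℝ) < Fintype.card G := by linarith
  have hApos : ∀ i, 0 < (A i).card := by
    intro i
    have h1 := (hA i).1
    have : (0 : ℝ) < c * (Fintype.card G : ℝ) ^ (1 - η) := by positivity
    exact_mod_cast this.trans_le h1
  have hm : m ≤ Fintype.card G := by
    choose a ha using fun i => Finset.card_pos.1 (hApos i)
    have hinj : Function.Injective a := by
      intro i j hij
      exact (hpart (a i)).unique (ha i) (hij ▸ ha j)
    simpa using Fintype.card_le_of_injective a hinj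
  have hlog : 0 ≤ Real.log (Fintype.card G) := Real.log_nonneg (by linarith)
  obtain ⟨B, hB1, hB2⟩ := exists_real_basis S hS D hD hN m A hm hApos
    (fun i => 128 / Real.sqrt c * Real.log (Fintype.card G) /
      (Fintype.card G : ℝ) ^ (ε / 2) * (((A i).card : ℝ) / (Fintype.card G : ℝ)))
    (fun i => by positivity) (by
      intro d hd i
      set N : ℝ := (Fintype.card G : ℝ) with hNdef
      set τ : ℝ := d * (A i).card / N with hτ
      have hτle : c * N ^ ε ≤ τ := by
        rw [hτ, le_div_iff₀ hN0]
        have h1 : N ^ s ≤ d := hsD.trans (by exact_mod_cast hd)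
        have h2 := (hA i).1
        calc c * N ^ ε * N = N ^ s * (c * N ^ (1 - η)) := by
              rw [mul_left_comm, ← Real.rpow_add hN0, mul_assoc]
              congr 1
              nth_rewrite 2 [← Real.rpow_one N]
              rw [← Real.rpow_add hN0]
              congr 1
              rw [hηs]; ring
          _ ≤ _ := by gcongr
      have hτ0 : 0 < τ := lt_of_lt_of_le (by positivity) hτle
      have hsqrt : Real.sqrt c * N ^ (ε / 2) ≤ Real.sqrt τ := by
        apply Real.le_sqrt_of_sq_le
        rw [mul_pow, Real.sq_sqrt hc.le, ← Real.rpow_natCast, ← Real.rpow_mul hN0.le]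
        refine le_trans (le_of_eq ?_) hτle
        congr 2
        push_cast; ring
      have hsc : 0 < Real.sqrt c := Real.sqrt_pos.2 hc
      have hpos : 0 < Real.sqrt c * N ^ (ε / 2) := by positivity
      have e1 : (d : ℝ) * (128 / Real.sqrt c * Real.log N / N ^ (ε / 2) * ((A i).card / N))
          = 128 * Real.log N * (τ / (Real.sqrt c * N ^ (ε / 2))) := by
        rw [hτ]; field_simp
      rw [e1]
      refine mul_le_mul_of_nonneg_left ?_ (by positivity)
      rw [le_div_iff₀ hpos]
      calc Real.sqrt τ * (Real.sqrt c * N ^ (ε / 2)) ≤ Real.sqrt τ * Real.sqrt τ := by gcongr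
        _ = τ := Real.mul_self_sqrt hτ0.le)
  obtain ⟨B', hB'⟩ := exists_complex_basis B
  refine ⟨B', fun φ => ⟨fun g => by rw [hB']; simp, ?_⟩, fun i φ => ?_⟩
  · obtain ⟨μ, hμ⟩ := hB1 φ
    refine ⟨μ, fun g => ?_⟩
    simp only [hB']
    exact_mod_cast hμ g
  · have : ∀ g, ‖B' φ g‖ ^ 2 = B φ g ^ 2 := fun g => by
      rw [hB', Complex.norm_real, Real.norm_eq_abs, sq_abs]
    simp only [this]
    exact hB2 i φ
end

section
/- For each n let G_n = Sym(n) be the symmetric group on n letters, let S_n ⊆ G_n be a symmetric subset, and let M_n be positive integers with M_n/n → 0 as n → ∞. Then for any functions f_1^n, …, f_{M_n}^n : G_n → ℝ there exists n₀ such that for all n ≥ n₀ there is an orthonormal basis B_n of ℓ²(G_n) consisting of real-valued eigenfunctions of the adjacency operator of Cay(G_n, S_n) such that for every φ ∈ B_n and every i = 1, …, M_n one has |Σ_{g∈G_n} f_i^n(g)|φ(g)|² − (1/|G_n|)·Σ_{g∈G_n} f_i^n(g)| ≤ 192·(log n)/√n · ‖f_i^n‖_{ℓ²}/√(|G_n|).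 -/
open scoped BigOperators

namespace QUE

section A
variable {E : Type*} [NormedAddCommGroup E] [InnerProductSpace ℝ E]

lemma second_deriv {J : Type*} [Fintype J] (a b c : J → ℝ)
    (h : ∀ t : ℝ, ∑ j, (Real.exp (a j) + Real.exp (b j)) ≤
      ∑ j, (Real.exp ((a j + b j) / 2 + (a j - b j) / 2 * Real.cos t + c j * Real.sin t) +
        Real.exp ((a j + b j) / 2 - (a j - b j) / 2 * Real.cos t - c j * Real.sin t))) :
    ∑ j, (a j - b j) * (Real.exp (a j) - Real.exp (b j)) ≤
      2 * ∑ j, c j ^ 2 * (Real.exp (a j) + Real.exp (b j)) := by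
  set A : J → ℝ → ℝ := fun j t => (a j + b j) / 2 + (a j - b j) / 2 * Real.cos t + c j * Real.sin t with hA
  set B : J → ℝ → ℝ := fun j t => (a j + b j) / 2 - (a j - b j) / 2 * Real.cos t - c j * Real.sin t with hB
  set A' : J → ℝ → ℝ := fun j t => - ((a j - b j) / 2) * Real.sin t + c j * Real.cos t with hA'
  set A'' : J → ℝ → ℝ := fun j t => - ((a j - b j) / 2) * Real.cos t - c j * Real.sin t with hA''
  set g : ℝ → ℝ := fun t => ∑ j, (Real.exp (A j t) + Real.exp (B j t)) with hg
  set g' : ℝ → ℝ := fun t => ∑ j, (Real.exp (A j t) * A' j t + Real.exp (B j t) * (- A' j t)) with hg'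
  have dA : ∀ j t, HasDerivAt (A j) (A' j t) t := by
    intro j t
    have := (((Real.hasDerivAt_cos t).const_mul ((a j - b j) / 2)).const_add ((a j + b j) / 2)).add
      ((Real.hasDerivAt_sin t).const_mul (c j))
    refine this.congr_deriv ?_
    simp only [hA']; ring
  have dB : ∀ j t, HasDerivAt (B j) (- A' j t) t := by
    intro j t
    have := (((Real.hasDerivAt_cos t).const_mul ((a j - b j) / 2)).const_sub ((a j + b j) / 2)).sub
      ((Real.hasDerivAt_sin t).const_mul (c j))
    refine this.congr_deriv ?_
    simp only [hA']; ring
  have dA' : ∀ j t, HasDerivAt (A' j) (A'' j t) t := by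
    intro j t
    have := (((Real.hasDerivAt_sin t).const_mul (-((a j - b j) / 2)))).add
      ((Real.hasDerivAt_cos t).const_mul (c j))
    refine this.congr_deriv ?_
    simp only [hA'']; ring
  have dg : ∀ t, HasDerivAt g (g' t) t := by
    intro t
    exact HasDerivAt.fun_sum fun j _ => ((dA j t).exp.add (dB j t).exp)
  have dg' : HasDerivAt g' (∑ j, ((Real.exp (A j 0) * A' j 0) * A' j 0 + Real.exp (A j 0) * A'' j 0
      + ((Real.exp (B j 0) * (-A' j 0)) * (- A' j 0) + Real.exp (B j 0) * (-A'' j 0)))) 0 := by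
    exact HasDerivAt.fun_sum fun j _ => (((dA j 0).exp.mul (dA' j 0)).add ((dB j 0).exp.mul (dA' j 0).neg))
  have hA0 : ∀ j, A j 0 = a j := by intro j; simp only [hA, Real.cos_zero, Real.sin_zero]; ring
  have hB0 : ∀ j, B j 0 = b j := by intro j; simp only [hB, Real.cos_zero, Real.sin_zero]; ring
  have hmin : ∀ t, g 0 ≤ g t := by
    intro t
    have := h t
    simp only [hg, hA0, hB0]
    exact this
  have hlm : IsLocalMin g 0 := Filter.Eventually.of_forall hmin
  have hderiv : deriv g = g' := funext fun t => (dg t).deriv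
  by_contra hcon
  push Not at hcon
  have hneg : deriv (deriv g) 0 < 0 := by
    rw [hderiv, dg'.deriv]
    simp only [hA0, hB0, hA', hA'', Real.cos_zero, Real.sin_zero]
    rw [Finset.mul_sum] at hcon
    have : ∑ j, ((Real.exp (a j) * (-((a j - b j) / 2) * 0 + c j * 1)) * (-((a j - b j) / 2) * 0 + c j * 1) + Real.exp (a j) * (-((a j - b j) / 2) * 1 - c j * 0)
      + ((Real.exp (b j) * (-(-((a j - b j) / 2) * 0 + c j * 1))) * (- (-((a j - b j) / 2) * 0 + c j * 1)) + Real.exp (b j) * (-(-((a j - b j) / 2) * 1 - c j * 0))))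
      = (1/2) * (∑ j, 2 * (c j ^ 2 * (Real.exp (a j) + Real.exp (b j))) - ∑ j, (a j - b j) * (Real.exp (a j) - Real.exp (b j))) := by
      rw [← Finset.sum_sub_distrib, Finset.mul_sum]
      refine Finset.sum_congr rfl fun j _ => ?_
      ring
    rw [this]; linarith
  have hmax : IsLocalMax g 0 := isLocalMax_of_deriv_deriv_neg hneg hlm.deriv_eq_zero (dg 0).continuousAt
  have hconst : g =ᶠ[nhds 0] fun _ => g 0 := by
    filter_upwards [hmax] with t ht
    exact le_antisymm ht (hmin t)
  have h1 : deriv g =ᶠ[nhds 0] deriv (fun _ : ℝ => g 0) := hconst.deriv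
  have h2 := h1.deriv_eq
  simp at h2
  linarith

lemma exists_min [FiniteDimensional ℝ E] {ι : Type*} [Fintype ι] (Φ : (ι → E) → ℝ) (hΦ : Continuous Φ)
    (b₀ : ι → E) (hb₀ : Orthonormal ℝ b₀) :
    ∃ b : ι → E, Orthonormal ℝ b ∧ ∀ b', Orthonormal ℝ b' → Φ b ≤ Φ b' := by
  classical
  have hcl : IsClosed {b : ι → E | Orthonormal ℝ b} := by
    simp only [orthonormal_iff_ite, Set.ofPred_forall]
    refine isClosed_iInter fun i => isClosed_iInter fun j => ?_
    exact isClosed_eq (by fun_prop) continuous_const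
  have hbd : Bornology.IsBounded {b : ι → E | Orthonormal ℝ b} := by
    refine (Metric.isBounded_closedBall (x := (0 : ι → E)) (r := 1)).subset ?_
    intro b hb
    rw [mem_closedBall_zero_iff, pi_norm_le_iff_of_nonneg zero_le_one]
    intro i
    exact (hb.1 i).le
  have : ProperSpace E := FiniteDimensional.proper ℝ E
  have hcpt : IsCompact {b : ι → E | Orthonormal ℝ b} := Metric.isCompact_of_isClosed_isBounded hcl hbd
  obtain ⟨b, hb, hm⟩ := hcpt.exists_isMinOn ⟨b₀, hb₀⟩ hΦ.continuousOn
  exact ⟨b, hb, fun b' hb' => hm hb'⟩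

/-- Rotation of a tuple in the plane of the vectors `k` and `l`. -/
noncomputable def rot {ι : Type*} [DecidableEq ι] (b : ι → E) (k l : ι) (θ : ℝ) : ι → E := fun i =>
  if i = k then Real.cos θ • b k + Real.sin θ • b l
  else if i = l then -Real.sin θ • b k + Real.cos θ • b l else b i

lemma rot_orthonormal {ι : Type*} [DecidableEq ι] {b : ι → E} (hb : Orthonormal ℝ b) {k l : ι}
    (hkl : k ≠ l) (θ : ℝ) : Orthonormal ℝ (rot b k l θ) := by
  have hb' := orthonormal_iff_ite.1 hb
  have hcs := Real.sin_sq_add_cos_sq θ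
  rw [orthonormal_iff_ite]
  intro i j
  by_cases hik : i = k <;> by_cases hil : i = l <;> by_cases hjk : j = k <;> by_cases hjl : j = l <;>
  simp_all [rot, inner_add_left, inner_add_right, inner_smul_left, inner_smul_right,
    -inner_self_eq_norm_sq_to_K, eq_comm] <;>
  nlinarith [Real.sin_sq_add_cos_sq θ]

lemma lemA [FiniteDimensional ℝ E] {J ι : Type*} [Fintype J] [Fintype ι] (P : J → E →ₗ[ℝ] E)
    (hP : ∀ j, (P j).IsSymmetric) (b₀ : OrthonormalBasis ι ℝ E) :
    ∃ b : OrthonormalBasis ι ℝ E,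
      (Fintype.card ι : ℝ) * ∑ j, ∑ k, inner ℝ (b k) (P j (b k)) * Real.exp (inner ℝ (b k) (P j (b k)))
        - ∑ j, (∑ k, inner ℝ (b k) (P j (b k))) * (∑ k, Real.exp (inner ℝ (b k) (P j (b k))))
      ≤ 2 * ∑ j, ∑ k, Real.exp (inner ℝ (b k) (P j (b k))) * ‖P j (b k)‖ ^ 2 := by
  classical
  obtain ⟨b₁, hb₁, hmin⟩ := exists_min (E := E) (ι := ι)
    (fun b => ∑ k, ∑ j, Real.exp (inner ℝ (b k) (P j (b k)))) (by
      have : ∀ j, Continuous (P j) := fun j => (P j).continuous_of_finiteDimensional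
      fun_prop) b₀ b₀.orthonormal
  have hcard : Fintype.card ι = Module.finrank ℝ E := (Module.finrank_eq_card_basis b₀.toBasis).symm
  have hspan : ⊤ ≤ Submodule.span ℝ (Set.range b₁) := by
    have := hb₁.linearIndependent.span_eq_top_of_card_eq_finrank' hcard
    exact this.ge
  let b : OrthonormalBasis ι ℝ E := OrthonormalBasis.mk hb₁ hspan
  have hbb : ∀ k, b k = b₁ k := fun k => by simp [b]
  refine ⟨b, ?_⟩
  simp only [hbb]
  set p : J → ι → ι → ℝ := fun j k l => inner ℝ (b₁ k) (P j (b₁ l)) with hp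
  have psymm : ∀ j k l, p j k l = p j l k := by
    intro j k l
    simp only [hp]
    rw [← hP j, real_inner_comm]
  have key : ∀ k l, ∑ j, (p j k k - p j l l) * (Real.exp (p j k k) - Real.exp (p j l l)) ≤
      2 * ∑ j, p j k l ^ 2 * (Real.exp (p j k k) + Real.exp (p j l l)) := by
    intro k l
    by_cases hkl : k = l
    · subst hkl
      simp only [sub_self, mul_zero, Finset.sum_const_zero]
      positivity
    apply second_deriv
    intro t
    have h := hmin _ (rot_orthonormal hb₁ hkl (t / 2))
    have hl' : l ∈ Finset.univ.erase k := by simp [Ne.symm hkl]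
    rw [← Finset.add_sum_erase _ _ (Finset.mem_univ k), ← Finset.add_sum_erase _ _ hl',
      ← Finset.add_sum_erase _ (fun k_1 => ∑ j, Real.exp (inner ℝ (rot b₁ k l (t / 2) k_1) (P j (rot b₁ k l (t / 2) k_1)))) (Finset.mem_univ k),
      ← Finset.add_sum_erase _ (fun k_1 => ∑ j, Real.exp (inner ℝ (rot b₁ k l (t / 2) k_1) (P j (rot b₁ k l (t / 2) k_1)))) hl'] at h
    have hrest : ∑ x ∈ (Finset.univ.erase k).erase l, ∑ j, Real.exp (inner ℝ (rot b₁ k l (t / 2) x) (P j (rot b₁ k l (t / 2) x))) =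
        ∑ x ∈ (Finset.univ.erase k).erase l, ∑ j, Real.exp (inner ℝ (b₁ x) (P j (b₁ x))) := by
      refine Finset.sum_congr rfl fun x hx => ?_
      simp only [Finset.mem_erase, Finset.mem_univ, and_true, ne_eq] at hx
      simp [rot, hx.1, hx.2]
    rw [hrest] at h
    have hc : Real.cos t = 2 * Real.cos (t/2) ^ 2 - 1 := by rw [← Real.cos_two_mul]; ring_nf
    have hs : Real.sin t = 2 * Real.sin (t/2) * Real.cos (t/2) := by rw [← Real.sin_two_mul]; ring_nf
    have hcs := Real.sin_sq_add_cos_sq (t/2)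
    have e1 : ∀ j, inner ℝ (rot b₁ k l (t / 2) k) (P j (rot b₁ k l (t / 2) k)) =
        (p j k k + p j l l) / 2 + (p j k k - p j l l) / 2 * Real.cos t + p j k l * Real.sin t := by
      intro j
      have h1 : inner ℝ (b₁ l) (P j (b₁ k)) = p j k l := psymm j l k
      simp only [rot, if_true, map_add, map_smul, inner_add_left, inner_add_right, inner_smul_left,
        inner_smul_right, h1, hc, hs]
      simp only [conj_trivial, hp]
      linear_combination (inner ℝ (b₁ l) (P j (b₁ l))) * hcs
    have e2 : ∀ j, inner ℝ (rot b₁ k l (t / 2) l) (P j (rot b₁ k l (t / 2) l)) =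
        (p j k k + p j l l) / 2 - (p j k k - p j l l) / 2 * Real.cos t - p j k l * Real.sin t := by
      intro j
      have h1 : inner ℝ (b₁ l) (P j (b₁ k)) = p j k l := psymm j l k
      simp only [rot, if_true, if_neg (Ne.symm hkl), map_add, map_smul, inner_add_left, inner_add_right, inner_smul_left,
        inner_smul_right, h1, hc, hs]
      simp only [conj_trivial, hp]
      linear_combination (inner ℝ (b₁ k) (P j (b₁ k))) * hcs
    simp only [e1, e2] at h
    simp only [Finset.sum_add_distrib]
    linarith
  have hpars : ∀ j k, ∑ l, p j k l ^ 2 = ‖P j (b₁ k)‖ ^ 2 := by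
    intro j k
    have := b.sum_sq_norm_inner_right (P j (b₁ k))
    rw [← this]
    refine Finset.sum_congr rfl fun l _ => ?_
    rw [psymm, hbb, Real.norm_eq_abs, sq_abs]
  have hsum := Finset.sum_le_sum fun k (_ : k ∈ Finset.univ) =>
    Finset.sum_le_sum fun l (_ : l ∈ Finset.univ) => key k l
  have hL : ∑ k, ∑ l, ∑ j, (p j k k - p j l l) * (Real.exp (p j k k) - Real.exp (p j l l)) =
      2 * ((Fintype.card ι : ℝ) * ∑ j, ∑ k, p j k k * Real.exp (p j k k)
        - ∑ j, (∑ k, p j k k) * (∑ k, Real.exp (p j k k))) := by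
    rw [Finset.mul_sum, ← Finset.sum_sub_distrib, Finset.mul_sum]
    rw [Finset.sum_congr rfl fun k _ => Finset.sum_comm, Finset.sum_comm]
    refine Finset.sum_congr rfl fun j _ => ?_
    have : ∀ k l, (p j k k - p j l l) * (Real.exp (p j k k) - Real.exp (p j l l)) =
      p j k k * Real.exp (p j k k) - p j k k * Real.exp (p j l l) - p j l l * Real.exp (p j k k)
       + p j l l * Real.exp (p j l l) := fun k l => by ring
    simp only [this, Finset.sum_add_distrib, Finset.sum_sub_distrib, Finset.sum_const,
      Finset.card_univ, nsmul_eq_mul, ← Finset.mul_sum, ← Finset.sum_mul]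
    ring
  have hR : ∑ k, ∑ l, 2 * ∑ j, p j k l ^ 2 * (Real.exp (p j k k) + Real.exp (p j l l)) =
      2 * (2 * ∑ j, ∑ k, Real.exp (p j k k) * ‖P j (b₁ k)‖ ^ 2) := by
    simp only [← Finset.mul_sum]
    congr 1
    rw [Finset.sum_congr rfl fun k _ => Finset.sum_comm, Finset.sum_comm, Finset.mul_sum]
    refine Finset.sum_congr rfl fun j _ => ?_
    simp only [mul_add, Finset.sum_add_distrib]
    have h1 : ∑ k, ∑ l, p j k l ^ 2 * Real.exp (p j k k) = ∑ k, Real.exp (p j k k) * ‖P j (b₁ k)‖ ^ 2 := by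
      refine Finset.sum_congr rfl fun k _ => ?_
      rw [← hpars, ← Finset.sum_mul, mul_comm]
    have h2 : ∑ k, ∑ l, p j k l ^ 2 * Real.exp (p j l l) = ∑ k, Real.exp (p j k k) * ‖P j (b₁ k)‖ ^ 2 := by
      rw [Finset.sum_comm, ← h1]
      refine Finset.sum_congr rfl fun k _ => Finset.sum_congr rfl fun l _ => ?_
      rw [psymm j l k]
    rw [h1, h2]; ring
  rw [hL, hR] at hsum
  linarith

end A
end QUE
namespace QUE
section B
variable {E : Type*} [NormedAddCommGroup E] [InnerProductSpace ℝ E]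

lemma elem_ineq (y w : ℝ) (hw : 0 ≤ w) :
    (1 / 8 : ℝ) * (Real.exp w * Real.cosh y) - 2 ≤
      Real.exp w * (2 * (y * Real.sinh y) + (w - 1 / 8) * Real.cosh y) := by
  have hc := Real.cosh_pos y
  have hys : 0 ≤ y * Real.sinh y := by
    rcases le_total 0 y with h | h
    · exact mul_nonneg h (Real.sinh_nonneg_iff.2 h)
    · exact mul_nonneg_of_nonpos_of_nonpos h (Real.sinh_nonpos_iff.2 h)
  have hE := Real.exp_pos w
  suffices h : Real.exp w * ((1 / 4 - w) * Real.cosh y - 2 * (y * Real.sinh y)) ≤ 2 by linarith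
  by_cases hw4 : 1 / 4 ≤ w
  · have : (1 / 4 - w) * Real.cosh y - 2 * (y * Real.sinh y) ≤ 0 := by nlinarith
    nlinarith
  push Not at hw4
  have hmain : Real.cosh y / 4 - 2 * (y * Real.sinh y) ≤ 1 := by
    wlog hy : 0 ≤ y generalizing y
    · have := this (-y) (by simpa using hc) (by simpa using hys) (by linarith)
      simpa using this
    have h1 := Real.cosh_sub_sinh y
    by_cases hy1 : 1 ≤ y
    · have hs0 : 0 ≤ Real.sinh y := Real.sinh_nonneg_iff.2 hy
      have : Real.exp (-y) ≤ 1 := Real.exp_le_one_iff.2 (by linarith)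
      nlinarith
    · have : Real.cosh y ≤ Real.cosh 1 := Real.cosh_le_cosh.2 (by
        rw [abs_of_nonneg hy]; simp; linarith)
      have h2 : Real.cosh 1 ≤ Real.exp 1 := by
        rw [Real.cosh_eq]
        have : Real.exp (-1) ≤ Real.exp 1 := Real.exp_le_exp.2 (by norm_num)
        linarith
      have := Real.exp_one_lt_d9
      linarith
  have hE2 : Real.exp w ≤ 2 := by
    have : Real.exp w ≤ Real.exp (1/2) := Real.exp_le_exp.2 (by linarith)
    have h3 : Real.exp (1/2) * Real.exp (1/2) = Real.exp 1 := by rw [← Real.exp_add]; norm_num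
    have := Real.exp_one_lt_d9
    nlinarith [Real.exp_pos (1/2 : ℝ)]
  have hb : (1 / 4 - w) * Real.cosh y - 2 * (y * Real.sinh y) ≤ 1 := by nlinarith
  nlinarith

lemma lemB [FiniteDimensional ℝ E] {I ι : Type*} [Fintype I] [Fintype ι] (T : I → E →ₗ[ℝ] E)
    (hT : ∀ i, (T i).IsSymmetric) (b₀ : OrthonormalBasis ι ℝ E)
    (htr : ∀ i, ∀ b : OrthonormalBasis ι ℝ E, ∑ k, inner ℝ (b k) (T i (b k)) = 0)
    (hHS : ∀ i, ∀ b : OrthonormalBasis ι ℝ E, ∑ k, ‖T i (b k)‖ ^ 2 ≤ 1) :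
    ∃ b : OrthonormalBasis ι ℝ E, ∀ i k, |inner ℝ (b k) (T i (b k))| ≤
      16 / (Fintype.card ι : ℝ) * Real.log (32 * (Fintype.card ι) * (Fintype.card I)) := by
  classical
  by_cases hι : IsEmpty ι
  · exact ⟨b₀, fun i k => (hι.false k).elim⟩
  by_cases hI : IsEmpty I
  · exact ⟨b₀, fun i k => (hI.false i).elim⟩
  rw [not_isEmpty_iff] at hι hI
  set D : ℝ := (Fintype.card ι : ℝ) with hD
  have hDpos : 0 < D := by
    rw [hD]; exact_mod_cast Fintype.card_pos
  have hop : ∀ i x, ‖T i x‖ ^ 2 ≤ ‖x‖ ^ 2 := by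
    intro i x
    rw [← b₀.sum_sq_norm_inner_right (T i x)]
    calc ∑ k, ‖inner ℝ (b₀ k) (T i x)‖ ^ 2 ≤ ∑ k, ‖T i (b₀ k)‖ ^ 2 * ‖x‖ ^ 2 := by
          refine Finset.sum_le_sum fun k _ => ?_
          rw [← hT i, ← mul_pow]
          exact pow_le_pow_left₀ (norm_nonneg _) (norm_inner_le_norm _ _) 2
      _ ≤ ‖x‖ ^ 2 := by
          rw [← Finset.sum_mul]
          have := hHS i b₀
          nlinarith [sq_nonneg ‖x‖]
  let sg : Bool → ℝ := fun e => if e then 1 else -1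
  let P : I × Bool → E →ₗ[ℝ] E := fun j => (D / 16) • (sg j.2 • T j.1 + T j.1 ∘ₗ T j.1)
  have hPapp : ∀ j x, P j x = (D / 16) • (sg j.2 • T j.1 x + T j.1 (T j.1 x)) := fun j x => rfl
  obtain ⟨b, hb⟩ := lemA P (by
    intro j x y
    simp only [hPapp, inner_smul_left, inner_smul_right, inner_add_left, inner_add_right, hT j.1 _ _]
    simp) b₀
  refine ⟨b, ?_⟩
  set y : I → ι → ℝ := fun i k => D / 16 * inner ℝ (b k) (T i (b k)) with hy
  set w : I → ι → ℝ := fun i k => D / 16 * ‖T i (b k)‖ ^ 2 with hw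
  have hw0 : ∀ i k, 0 ≤ w i k := fun i k => by positivity
  have hPin : ∀ j k, inner ℝ (b k) (P j (b k)) = sg j.2 * y j.1 k + w j.1 k := by
    intro j k
    simp only [hPapp, inner_smul_right, inner_add_right, hy, hw]
    rw [← hT j.1 (b k) (T j.1 (b k)), real_inner_self_eq_norm_sq]
    ring
  have hPn : ∀ j k, ‖P j (b k)‖ ^ 2 ≤ D / 4 * w j.1 k := by
    intro j k
    rw [hPapp, norm_smul, mul_pow]
    have h1 : ‖sg j.2 • T j.1 (b k) + T j.1 (T j.1 (b k))‖ ≤ ‖T j.1 (b k)‖ + ‖T j.1 (T j.1 (b k))‖ := by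
      refine (norm_add_le _ _).trans (add_le_add_left ?_ _)
      rw [norm_smul]
      have : ‖sg j.2‖ = 1 := by rcases j with ⟨i, _ | _⟩ <;> simp [sg]
      rw [this, one_mul]
    have h2 : ‖T j.1 (T j.1 (b k))‖ ≤ ‖T j.1 (b k)‖ :=
      (sq_le_sq₀ (norm_nonneg _) (norm_nonneg _)).1 (hop _ _)
    have h3 : ‖sg j.2 • T j.1 (b k) + T j.1 (T j.1 (b k))‖ ^ 2 ≤ (2 * ‖T j.1 (b k)‖) ^ 2 :=
      pow_le_pow_left₀ (norm_nonneg _) (by linarith) 2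
    have h4 : ‖D / 16‖ ^ 2 = (D / 16) ^ 2 := by rw [Real.norm_eq_abs, sq_abs]
    rw [h4]
    simp only [hw]
    nlinarith [sq_nonneg (D / 16)]
  have htrP : ∀ j, ∑ k, inner ℝ (b k) (P j (b k)) ≤ D / 16 := by
    intro j
    simp only [hPin, Finset.sum_add_distrib, ← Finset.mul_sum, hy, hw, htr]
    have := hHS j.1 b
    nlinarith
  -- combine
  have hmain : ∑ i, ∑ k, Real.exp (w i k) *
      (2 * (y i k * Real.sinh (y i k)) + (w i k - 1 / 8) * Real.cosh (y i k)) ≤ 0 := by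
    have h1 : ∑ j, (∑ k, inner ℝ (b k) (P j (b k))) * (∑ k, Real.exp (inner ℝ (b k) (P j (b k))))
       ≤ ∑ j, (D / 16) * (∑ k, Real.exp (inner ℝ (b k) (P j (b k)))) := by
      refine Finset.sum_le_sum fun j _ => ?_
      exact mul_le_mul_of_nonneg_right (htrP j) (by positivity)
    have h2 : ∑ j, ∑ k, Real.exp (inner ℝ (b k) (P j (b k))) * ‖P j (b k)‖ ^ 2
       ≤ ∑ j, ∑ k, Real.exp (inner ℝ (b k) (P j (b k))) * (D / 4 * w j.1 k) := by
      refine Finset.sum_le_sum fun j _ => Finset.sum_le_sum fun k _ => ?_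
      exact mul_le_mul_of_nonneg_left (hPn j k) (by positivity)
    have h3 : D * ∑ j, ∑ k, inner ℝ (b k) (P j (b k)) * Real.exp (inner ℝ (b k) (P j (b k)))
        - ∑ j, (D / 16) * (∑ k, Real.exp (inner ℝ (b k) (P j (b k))))
        - 2 * ∑ j, ∑ k, Real.exp (inner ℝ (b k) (P j (b k))) * (D / 4 * w j.1 k) ≤ 0 := by
      linarith
    have h4 : D * ∑ j, ∑ k, inner ℝ (b k) (P j (b k)) * Real.exp (inner ℝ (b k) (P j (b k)))
        - ∑ j, (D / 16) * (∑ k, Real.exp (inner ℝ (b k) (P j (b k))))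
        - 2 * ∑ j, ∑ k, Real.exp (inner ℝ (b k) (P j (b k))) * (D / 4 * w j.1 k)
        = D * ∑ i, ∑ k, Real.exp (w i k) *
      (2 * (y i k * Real.sinh (y i k)) + (w i k - 1 / 8) * Real.cosh (y i k)) := by
      simp only [hPin]
      simp only [Finset.mul_sum, ← Finset.sum_sub_distrib]
      rw [Fintype.sum_prod_type]
      refine Finset.sum_congr rfl fun i _ => ?_
      rw [Fintype.sum_bool, ← Finset.sum_add_distrib]
      refine Finset.sum_congr rfl fun k _ => ?_
      simp only [sg, if_true, Bool.false_eq_true, if_false]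
      rw [Real.exp_add, Real.exp_add, Real.sinh_eq, Real.cosh_eq]
      ring_nf
    rw [h4] at h3
    by_contra hcon
    push Not at hcon
    have := mul_pos hDpos hcon
    linarith
  have hX : ∑ i, ∑ k, Real.exp (w i k) * Real.cosh (y i k) ≤ 16 * D * (Fintype.card I : ℝ) := by
    have h1 := Finset.sum_le_sum fun i (_ : i ∈ Finset.univ) =>
      Finset.sum_le_sum fun k (_ : k ∈ Finset.univ) => elem_ineq (y i k) (w i k) (hw0 i k)
    have h2 := h1.trans hmain
    simp only [Finset.sum_sub_distrib, ← Finset.mul_sum, Finset.sum_const, Finset.card_univ,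
      nsmul_eq_mul] at h2
    rw [← hD] at h2
    linarith
  intro i k
  have h1 : Real.exp (w i k) * Real.cosh (y i k) ≤ ∑ i, ∑ k, Real.exp (w i k) * Real.cosh (y i k) := by
    refine (Finset.single_le_sum (f := fun k => Real.exp (w i k) * Real.cosh (y i k)) (fun k _ => ?_) (Finset.mem_univ k)).trans
      (Finset.single_le_sum (f := fun i => ∑ k, Real.exp (w i k) * Real.cosh (y i k)) (fun i _ => ?_) (Finset.mem_univ i))
    · exact mul_nonneg (Real.exp_pos _).le (Real.cosh_pos _).le
    · exact Finset.sum_nonneg fun k _ => mul_nonneg (Real.exp_pos _).le (Real.cosh_pos _).le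
  have h2 : Real.exp |y i k| ≤ 32 * D * (Fintype.card I : ℝ) := by
    have h3 : Real.exp |y i k| ≤ 2 * Real.cosh (y i k) := by
      rw [← Real.cosh_abs, Real.cosh_eq]
      have := Real.exp_pos (-|y i k|)
      linarith
    have h4 : 1 ≤ Real.exp (w i k) := Real.one_le_exp (hw0 i k)
    have h5 := Real.cosh_pos (y i k)
    nlinarith
  have h3 : |y i k| ≤ Real.log (32 * D * (Fintype.card I : ℝ)) := by
    rw [← Real.log_exp |y i k|]
    exact Real.log_le_log (Real.exp_pos _) h2
  have h4 : |inner ℝ (b k) (T i (b k))| = 16 / D * |y i k| := by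
    simp only [hy, abs_mul, abs_of_pos (show 0 < D / 16 by positivity)]
    field_simp
  rw [h4]
  exact mul_le_mul_of_nonneg_left h3 (by positivity)

end B
end QUE
namespace QUE
section C
variable {G : Type*} [Group G] [Fintype G]

/-- Left translation on real functions. -/
noncomputable def Lt (h : G) : EuclideanSpace ℝ G ≃ₗᵢ[ℝ] EuclideanSpace ℝ G :=
  LinearIsometryEquiv.piLpCongrLeft 2 ℝ ℝ (Equiv.mulLeft h)

lemma Lt_apply (h : G) (v : EuclideanSpace ℝ G) (x : G) : Lt h v x = v (h⁻¹ * x) := rfl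

lemma Lt_mul (g h : G) (v : EuclideanSpace ℝ G) : Lt (g * h) v = Lt g (Lt h v) := by
  ext x; simp [Lt_apply, mul_assoc]

lemma Lt_one (v : EuclideanSpace ℝ G) : Lt (1 : G) v = v := by
  ext x; simp [Lt_apply]

/-- Multiplication by a function. -/
noncomputable def mulOp (f : G → ℝ) : EuclideanSpace ℝ G →ₗ[ℝ] EuclideanSpace ℝ G where
  toFun v := WithLp.toLp 2 (fun g => f g * v g)
  map_add' u v := by ext g; simp [mul_add]
  map_smul' c v := by ext g; simp; ring

lemma mulOp_apply (f : G → ℝ) (v : EuclideanSpace ℝ G) (g : G) : mulOp f v g = f g * v g := rfl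

lemma kernel_diag (W : Submodule ℝ (EuclideanSpace ℝ G)) (hW : ∀ h, ∀ w ∈ W, Lt h w ∈ W)
    (b : OrthonormalBasis (Fin (Module.finrank ℝ W)) ℝ W) (g : G) :
    ∑ k, ((b k : EuclideanSpace ℝ G) g) ^ 2 = (Module.finrank ℝ W : ℝ) / Fintype.card G := by
  classical
  have h1 : ∀ (b : OrthonormalBasis (Fin (Module.finrank ℝ W)) ℝ W) (g : G),
      ∑ k, ((b k : EuclideanSpace ℝ G) g) ^ 2 = ‖W.orthogonalProjectionOnto (EuclideanSpace.single g (1:ℝ))‖ ^ 2 := by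
    intro b g
    rw [← b.sum_sq_norm_inner_right]
    refine Finset.sum_congr rfl fun k _ => ?_
    rw [Submodule.inner_orthogonalProjectionOnto_eq_of_mem_left]
    simp [EuclideanSpace.inner_single_right]
  have h2 : ∀ h : G, ∑ k, ((b k : EuclideanSpace ℝ G) (h⁻¹ * g)) ^ 2 = ∑ k, ((b k : EuclideanSpace ℝ G) g) ^ 2 := by
    intro h
    let v : Fin (Module.finrank ℝ W) → W := fun k => ⟨Lt h (b k), hW h _ (b k).2⟩
    have hv : Orthonormal ℝ v := by
      rw [orthonormal_iff_ite]
      intro i j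
      have := orthonormal_iff_ite.1 b.orthonormal i j
      rw [← this]
      simp only [v, Submodule.coe_inner, LinearIsometryEquiv.inner_map_map]
    let b' : OrthonormalBasis (Fin (Module.finrank ℝ W)) ℝ W := OrthonormalBasis.mk hv
      (hv.linearIndependent.span_eq_top_of_card_eq_finrank' (by simp)).ge
    have hb' : ∀ k, (b' k : EuclideanSpace ℝ G) = Lt h (b k) := fun k => by simp [b', v]
    rw [h1 b g, ← h1 b' g]
    simp only [hb', Lt_apply]
  have h3 : ∀ x : G, ∑ k, ((b k : EuclideanSpace ℝ G) x) ^ 2 = ∑ k, ((b k : EuclideanSpace ℝ G) g) ^ 2 := by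
    intro x
    have := h2 (g * x⁻¹)
    simpa using this
  have h4 : ∑ x : G, ∑ k, ((b k : EuclideanSpace ℝ G) x) ^ 2 = Module.finrank ℝ W := by
    rw [Finset.sum_comm]
    have : ∀ k, ∑ x : G, ((b k : EuclideanSpace ℝ G) x) ^ 2 = 1 := by
      intro k
      rw [← EuclideanSpace.real_norm_sq_eq, ← Submodule.coe_norm, b.orthonormal.1 k]; norm_num
    simp [this]
  simp only [h3] at h4
  rw [Finset.sum_const, Finset.card_univ, nsmul_eq_mul] at h4
  have : (Fintype.card G : ℝ) ≠ 0 := by exact_mod_cast Fintype.card_ne_zero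
  field_simp
  linarith

lemma lemC {I : Type*} [Fintype I] (W : Submodule ℝ (EuclideanSpace ℝ G)) (hW : ∀ h, ∀ w ∈ W, Lt h w ∈ W)
    (hD : 0 < Module.finrank ℝ W) (f : I → G → ℝ) :
    ∃ b : OrthonormalBasis (Fin (Module.finrank ℝ W)) ℝ W, ∀ k i,
      |∑ g, f i g * (b k : EuclideanSpace ℝ G) g ^ 2 - (∑ g, f i g) / (Fintype.card G : ℝ)| ≤
        16 * |Real.log (32 * (Module.finrank ℝ W) * (Fintype.card I))| / √(Module.finrank ℝ W) *
          (√(∑ g, f i g ^ 2) / √(Fintype.card G : ℝ)) := by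
  classical
  have hN : (0 : ℝ) < Fintype.card G := by exact_mod_cast Fintype.card_pos
  set D : ℝ := (Module.finrank ℝ W : ℝ) with hDdef
  have hDpos : 0 < D := by rw [hDdef]; exact_mod_cast hD
  set N : ℝ := (Fintype.card G : ℝ) with hNdef
  set f0 : I → G → ℝ := fun i g => f i g - (∑ x, f i x) / N with hf0
  have hf0sum : ∀ i, ∑ g, f0 i g = 0 := by
    intro i
    simp only [hf0, Finset.sum_sub_distrib, Finset.sum_const, Finset.card_univ, nsmul_eq_mul, ← hNdef]
    field_simp; ring
  have hf0sq : ∀ i, ∑ g, f0 i g ^ 2 ≤ ∑ g, f i g ^ 2 := by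
    intro i
    have : ∀ g, f i g ^ 2 = f0 i g ^ 2 + 2 * ((∑ x, f i x) / N) * f0 i g + ((∑ x, f i x) / N) ^ 2 := by
      intro g; simp only [hf0]; ring
    simp only [this, Finset.sum_add_distrib, ← Finset.mul_sum, hf0sum]
    have : 0 ≤ ∑ g : G, ((∑ x, f i x) / N) ^ 2 := by positivity
    linarith
  set H : I → ℝ := fun i => √(D / N * ∑ g, f0 i g ^ 2) with hH
  have hH2 : ∀ i, H i ^ 2 = D / N * ∑ g, f0 i g ^ 2 := fun i => Real.sq_sqrt (by positivity)
  set f1 : I → G → ℝ := fun i g => (H i)⁻¹ * f0 i g with hf1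
  have hf10 : ∀ i g, f0 i g = H i * f1 i g := by
    intro i g
    by_cases h : H i = 0
    · have h2 := hH2 i
      rw [h] at h2
      have h3 : ∑ g, f0 i g ^ 2 = 0 := by
        have : 0 < D / N := by positivity
        rcases mul_eq_zero.1 (h2.symm.trans (by norm_num)) with h | h
        · linarith
        · exact h
      have h4 := (Finset.sum_eq_zero_iff_of_nonneg (fun g _ => sq_nonneg (f0 i g))).1 h3 g (Finset.mem_univ g)
      rw [h, zero_mul]
      exact pow_eq_zero_iff (two_ne_zero) |>.1 h4
    · simp only [hf1]; field_simp
  let T : I → W →ₗ[ℝ] W := fun i =>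
    (W.orthogonalProjectionOnto : EuclideanSpace ℝ G →ₗ[ℝ] W) ∘ₗ mulOp (f1 i) ∘ₗ W.subtype
  have hTapp : ∀ i v, T i v = W.orthogonalProjectionOnto (mulOp (f1 i) (v : EuclideanSpace ℝ G)) := fun i v => rfl
  have hTin : ∀ i (u v : W), inner ℝ u (T i v) = ∑ g, f1 i g * ((u : EuclideanSpace ℝ G) g * (v : EuclideanSpace ℝ G) g) := by
    intro i u v
    rw [hTapp, Submodule.inner_orthogonalProjectionOnto_eq_of_mem_left, PiLp.inner_apply]
    refine Finset.sum_congr rfl fun g _ => ?_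
    simp [mulOp_apply]; ring
  obtain ⟨b, hb⟩ := lemB T (by
      intro i u v
      rw [hTin, real_inner_comm, hTin]
      refine Finset.sum_congr rfl fun g _ => by ring) (stdOrthonormalBasis ℝ W) (by
      intro i b
      simp only [hTin, ← sq]
      rw [Finset.sum_comm]
      simp only [← Finset.mul_sum, kernel_diag W hW b, ← Finset.sum_mul, hf1, hf0sum]
      simp) (by
      intro i b
      have h1 : ∀ k, ‖T i (b k)‖ ^ 2 ≤ ∑ g, f1 i g ^ 2 * (b k : EuclideanSpace ℝ G) g ^ 2 := by
        intro k
        have : ‖T i (b k)‖ ≤ ‖mulOp (f1 i) (b k : EuclideanSpace ℝ G)‖ :=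
          W.norm_orthogonalProjectionOnto_apply_le _
        refine (pow_le_pow_left₀ (norm_nonneg _) this 2).trans ?_
        rw [EuclideanSpace.real_norm_sq_eq]
        simp [mulOp_apply, mul_pow]
      refine (Finset.sum_le_sum fun k _ => h1 k).trans ?_
      rw [Finset.sum_comm]
      simp only [← Finset.mul_sum, kernel_diag W hW b, ← Finset.sum_mul, hf1, mul_pow]
      rw [mul_assoc, mul_comm (∑ g, f0 i g ^ 2), ← hDdef, ← hNdef, ← hH2, ← mul_pow]
      by_cases h : H i = 0
      · rw [h]; norm_num
      · rw [inv_mul_cancel₀ h]; norm_num)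
  refine ⟨b, fun k i => ?_⟩
  have hbk : ∑ g, (b k : EuclideanSpace ℝ G) g ^ 2 = 1 := by
    rw [← EuclideanSpace.real_norm_sq_eq, ← Submodule.coe_norm, b.orthonormal.1 k]; norm_num
  have e1 : ∑ g, f i g * (b k : EuclideanSpace ℝ G) g ^ 2 - (∑ g, f i g) / N =
      H i * inner ℝ (b k) (T i (b k)) := by
    rw [hTin, Finset.mul_sum]
    have : ∀ g, H i * (f1 i g * ((b k : EuclideanSpace ℝ G) g * (b k : EuclideanSpace ℝ G) g)) =
        f i g * (b k : EuclideanSpace ℝ G) g ^ 2 - (∑ g, f i g) / N * (b k : EuclideanSpace ℝ G) g ^ 2 := by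
      intro g
      rw [← mul_assoc, ← hf10]; simp only [hf0]; ring
    simp only [this, Finset.sum_sub_distrib, ← Finset.mul_sum, hbk, mul_one]
  have hb' := hb i k
  rw [Fintype.card_fin, ← hDdef] at hb'
  rw [e1, abs_mul, abs_of_nonneg (Real.sqrt_nonneg _)]
  have hHle : H i ≤ √D * (√(∑ g, f i g ^ 2) / √N) := by
    rw [← Real.sqrt_div' _ hN.le, ← Real.sqrt_mul hDpos.le]
    apply Real.sqrt_le_sqrt
    have := hf0sq i
    rw [div_mul_eq_mul_div, mul_div_assoc]
    gcongr
  calc H i * |inner ℝ (b k) (T i (b k))|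
      ≤ (√D * (√(∑ g, f i g ^ 2) / √N)) * (16 / D * |Real.log (32 * D * (Fintype.card I))|) := by
        apply mul_le_mul hHle (hb'.trans _) (abs_nonneg _) (by positivity)
        exact mul_le_mul_of_nonneg_left (le_abs_self _) (by positivity)
    _ = _ := by
        have : D = √D * √D := (Real.mul_self_sqrt hDpos.le).symm
        have h0 : √D ≠ 0 := by positivity
        have : √D * (16 / D) = 16 / √D := by
          rw [eq_div_iff h0]
          field_simp
          rw [Real.sq_sqrt hDpos.le]
        linear_combination (√(∑ g, f i g ^ 2) / √N * |Real.log (32 * D * (Fintype.card I))|) * this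

end C
end QUE
namespace QUE
section D
variable {n : ℕ}

lemma swap_sq (a b : Fin n) (v : EuclideanSpace ℝ (Equiv.Perm (Fin n))) :
    Lt (Equiv.swap a b) (Lt (Equiv.swap a b) v) = v := by
  rw [← Lt_mul, Equiv.swap_mul_self, Lt_one]

lemma rep_indep (k : ℕ) (x y : Fin (k + 2) → Fin n) (hx : Function.Injective x)
    (hy : Function.Injective y) (hxy : ∀ i j, x i ≠ y j)
    (W : Submodule ℝ (EuclideanSpace ℝ (Equiv.Perm (Fin n)))) (hW : ∀ h, ∀ w ∈ W, Lt h w ∈ W)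
    (w : EuclideanSpace ℝ (Equiv.Perm (Fin n))) (hw : w ∈ W)
    (hne : Lt (Equiv.swap (x 0) (y 0)) w ≠ Lt (Equiv.swap (x 1) (y 1)) w) :
    k ≤ Module.finrank ℝ W := by
  classical
  set τ : Fin (k + 2) → Equiv.Perm (Fin n) := fun i => Equiv.swap (x i) (y i) with hτ
  have τsq : ∀ i v, Lt (τ i) (Lt (τ i) v) = v := fun i v => swap_sq _ _ v
  have τcomm : ∀ i j v, Lt (τ i) (Lt (τ j) v) = Lt (τ j) (Lt (τ i) v) := by
    intro i j v
    by_cases hij : i = j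
    · rw [hij]
    rw [← Lt_mul, ← Lt_mul]
    congr 2
    have : Equiv.Perm.Disjoint (τ i) (τ j) := by
      apply Equiv.Perm.disjoint_swap_swap
      have h1 := hxy i i
      have h2 := hxy i j
      have h3 := hxy j i
      have h4 := hxy j j
      have h5 := hx.ne hij
      have h6 := hy.ne hij
      simp [h1, h2, h4, h5, h6, h3.symm]
    exact this.commute
  have step1 : ∃ v ∈ W, v ≠ 0 ∧ ∃ e : ℝ, Lt (τ 0) v = e • v ∧ Lt (τ 1) v = (-e) • v ∧ (e = 1 ∨ e = -1) := by
    set w' := Lt (τ 0) w - Lt (τ 1) w with hw'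
    have hw'0 : w' ≠ 0 := sub_ne_zero.2 hne
    have hw'W : w' ∈ W := W.sub_mem (hW _ _ hw) (hW _ _ hw)
    have h1 : Lt (τ 1) w' = - Lt (τ 0) w' := by
      simp only [hw', map_sub, τsq, τcomm 0 1 w]; abel
    by_cases h0 : w' + Lt (τ 0) w' = 0
    · refine ⟨w', hw'W, hw'0, -1, ?_, ?_, Or.inr rfl⟩
      · rw [neg_one_smul]; exact (neg_eq_of_add_eq_zero_right h0).symm
      · rw [h1, neg_neg, one_smul]; exact neg_eq_of_add_eq_zero_left h0
    · refine ⟨w' + Lt (τ 0) w', W.add_mem hw'W (hW _ _ hw'W), h0, 1, ?_, ?_, Or.inl rfl⟩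
      · rw [map_add, τsq, one_smul, add_comm]
      · rw [map_add, τcomm 1 0, h1, map_neg, τsq, neg_one_smul]; abel
  obtain ⟨v0, hv0W, hv00, e, he0, he1, he⟩ := step1
  have step2 : ∀ s : Finset (Fin (k + 2)), ∃ v ∈ W, v ≠ 0 ∧ Lt (τ 0) v = e • v ∧ Lt (τ 1) v = (-e) • v ∧
      ∀ i ∈ s, Lt (τ i) v = v ∨ Lt (τ i) v = - v := by
    intro s
    induction s using Finset.induction_on with
    | empty => exact ⟨v0, hv0W, hv00, he0, he1, by simp⟩
    | insert i s his ih =>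
      obtain ⟨v, hvW, hv0, h0, h1, hs⟩ := ih
      by_cases hz : v + Lt (τ i) v = 0
      · refine ⟨v, hvW, hv0, h0, h1, ?_⟩
        intro j hj
        rcases Finset.mem_insert.1 hj with rfl | hj
        · right; exact (neg_eq_of_add_eq_zero_right hz).symm
        · exact hs j hj
      · refine ⟨v + Lt (τ i) v, W.add_mem hvW (hW _ _ hvW), hz, ?_, ?_, ?_⟩
        · rw [map_add, τcomm 0 i, h0, map_smul, smul_add]
        · rw [map_add, τcomm 1 i, h1, map_smul, smul_add]
        · intro j hj
          rcases Finset.mem_insert.1 hj with rfl | hj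
          · left; rw [map_add, τsq, add_comm]
          · rcases hs j hj with h | h
            · left; rw [map_add, τcomm j i, h]
            · right; rw [map_add, τcomm j i, h, map_neg]; abel
  obtain ⟨v, hvW, hv0, h0, h1, hs⟩ := step2 Finset.univ
  have hε : ∀ i, ∃ ε : ℝ, (ε = 1 ∨ ε = -1) ∧ Lt (τ i) v = ε • v := by
    intro i
    rcases hs i (Finset.mem_univ i) with h | h
    · exact ⟨1, Or.inl rfl, by rw [h, one_smul]⟩
    · exact ⟨-1, Or.inr rfl, by rw [h, neg_one_smul]⟩
  choose ε hε1 hεv using hε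
  have hc : ∀ j : Fin k, ∃ c : Fin (k + 2), (c = 0 ∨ c = 1) ∧ Lt (τ c) v = (- ε j.succ.succ) • v := by
    intro j
    rcases hε1 j.succ.succ with h | h <;> rcases he with h' | h' <;> subst h'
    · exact ⟨1, Or.inr rfl, by rw [h1, h]⟩
    · exact ⟨0, Or.inl rfl, by rw [h0, h]⟩
    · exact ⟨0, Or.inl rfl, by rw [h0, h]; norm_num⟩
    · exact ⟨1, Or.inr rfl, by rw [h1, h]⟩
  choose c hc01 hcv using hc
  have hcj : ∀ i j : Fin k, j.succ.succ ≠ c i := by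
    intro i j
    rcases hc01 i with h | h <;> rw [h]
    · exact Fin.succ_ne_zero _
    · rw [← Fin.succ_zero_eq_one]
      exact fun h => Fin.succ_ne_zero _ (Fin.succ_injective _ h)
  set σ : Fin k → Equiv.Perm (Fin n) := fun i =>
    Equiv.swap (x i.succ.succ) (x (c i)) * Equiv.swap (y i.succ.succ) (y (c i)) with hσ
  have hσ1 : ∀ i, τ i.succ.succ * σ i = σ i * τ (c i) := by
    intro i
    simp only [hτ]
    rw [Equiv.mul_swap_eq_swap_mul]
    have e1 : σ i (x (c i)) = x i.succ.succ := by
      simp only [hσ, Equiv.Perm.mul_apply]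
      rw [Equiv.swap_apply_of_ne_of_ne (hxy _ _) (hxy _ _), Equiv.swap_apply_right]
    have e2 : σ i (y (c i)) = y i.succ.succ := by
      simp only [hσ, Equiv.Perm.mul_apply]
      rw [Equiv.swap_apply_right, Equiv.swap_apply_of_ne_of_ne (hxy _ _).symm (hxy _ _).symm]
    rw [e1, e2]
  have hσ2 : ∀ i j, i ≠ j → τ j.succ.succ * σ i = σ i * τ j.succ.succ := by
    intro i j hij
    have hji : j.succ.succ ≠ i.succ.succ := fun h =>
      hij (Fin.succ_injective _ (Fin.succ_injective _ h)).symm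
    simp only [hτ]
    rw [Equiv.mul_swap_eq_swap_mul]
    have e1 : σ i (x j.succ.succ) = x j.succ.succ := by
      simp only [hσ, Equiv.Perm.mul_apply]
      rw [Equiv.swap_apply_of_ne_of_ne (hxy _ _) (hxy _ _), Equiv.swap_apply_of_ne_of_ne (hx.ne hji) (hx.ne (hcj i j))]
    have e2 : σ i (y j.succ.succ) = y j.succ.succ := by
      simp only [hσ, Equiv.Perm.mul_apply]
      rw [Equiv.swap_apply_of_ne_of_ne (hy.ne hji) (hy.ne (hcj i j)), Equiv.swap_apply_of_ne_of_ne (hxy _ _).symm (hxy _ _).symm]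
    rw [e1, e2]
  let u : Fin k → W := fun i => ⟨Lt (σ i) v, hW _ _ hvW⟩
  have hu0 : ∀ i, u i ≠ 0 := by
    intro i h
    have : Lt (σ i) v = 0 := congrArg Subtype.val h
    exact hv0 ((map_eq_zero_iff _ (Lt (σ i)).injective).1 this)
  have huo : Pairwise fun i j => inner ℝ (u i) (u j) = 0 := by
    intro i j hij
    have e1 : Lt (τ i.succ.succ) (Lt (σ i) v) = (- ε i.succ.succ) • Lt (σ i) v := by
      rw [← Lt_mul, hσ1, Lt_mul, hcv, map_smul]
    have e2 : Lt (τ i.succ.succ) (Lt (σ j) v) = (ε i.succ.succ) • Lt (σ j) v := by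
      rw [← Lt_mul, hσ2 j i hij.symm, Lt_mul, hεv, map_smul]
    have e3 := (Lt (τ i.succ.succ)).inner_map_map (Lt (σ i) v) (Lt (σ j) v)
    rw [e1, e2, inner_smul_left, inner_smul_right] at e3
    simp only [conj_trivial] at e3
    change inner ℝ (Lt (σ i) v) (Lt (σ j) v) = 0
    rcases hε1 i.succ.succ with h | h <;> rw [h] at e3 <;> linarith
  have hli : LinearIndependent ℝ u := linearIndependent_of_ne_zero_of_inner_eq_zero hu0 huo
  simpa using hli.fintype_card_le_finrank

lemma inj4 {a b c d : Fin n} (h1 : a ≠ b) (h2 : a ≠ c) (h3 : a ≠ d) (h4 : b ≠ c) (h5 : b ≠ d)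
    (h6 : c ≠ d) : Function.Injective ![a, b, c, d] := by
  intro i j hij
  fin_cases i <;> fin_cases j <;> simp_all [eq_comm]

lemma rep_dichotomy (k : ℕ) (hn : 6 ≤ n) (hk : 2 * (k + 2) ≤ n)
    (W : Submodule ℝ (EuclideanSpace ℝ (Equiv.Perm (Fin n)))) (hW : ∀ h, ∀ w ∈ W, Lt h w ∈ W)
    (hW0 : W ≠ ⊥) :
    k ≤ Module.finrank ℝ W ∨ ∃ u ∈ W, u ≠ 0 ∧ ∀ h, Lt h u = u ∨ Lt h u = - u := by
  classical
  by_contra hcon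
  push Not at hcon
  obtain ⟨hlt, hno⟩ := hcon
  let x : Fin (k + 2) → Fin n := fun i => ⟨i, by omega⟩
  let y : Fin (k + 2) → Fin n := fun i => ⟨k + 2 + i, by omega⟩
  have hx : Function.Injective x := by
    intro i j h; simp only [x, Fin.mk.injEq] at h; exact Fin.ext h
  have hy : Function.Injective y := by
    intro i j h; simp only [y, Fin.mk.injEq] at h; exact Fin.ext (by omega)
  have hxy : ∀ i j, x i ≠ y j := by
    intro i j h; simp only [x, y, Fin.mk.injEq] at h; omega
  have h01 : ∀ w ∈ W, Lt (Equiv.swap (x 0) (y 0)) w = Lt (Equiv.swap (x 1) (y 1)) w := by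
    intro w hw
    by_contra hne
    exact absurd (rep_indep k x y hx hy hxy W hW w hw hne) (by omega)
  have h4 : ∀ a b c d : Fin n, Function.Injective ![a, b, c, d] → ∀ w ∈ W,
      Lt (Equiv.swap a b) w = Lt (Equiv.swap c d) w := by
    intro a b c d hinj w hw
    have h01' : (0 : Fin (k + 2)) ≠ 1 := by simp
    have hinj0 : Function.Injective ![x 0, y 0, x 1, y 1] :=
      inj4 (hxy 0 0) (hx.ne h01') (hxy 0 1) (hxy 1 0).symm (hy.ne h01') (hxy 1 1)
    obtain ⟨g, hg⟩ := (Equiv.Perm.isMultiplyPretransitive (Fin n) 4).exists_smul_eq ⟨_, hinj0⟩ ⟨_, hinj⟩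
    have hgi : ∀ i, g (![x 0, y 0, x 1, y 1] i) = ![a, b, c, d] i := fun i => congrArg (fun e => e i) hg
    have g0 : g (x 0) = a := hgi 0
    have g1 : g (y 0) = b := hgi 1
    have g2 : g (x 1) = c := hgi 2
    have g3 : g (y 1) = d := hgi 3
    have e1 : Equiv.swap a b = g * Equiv.swap (x 0) (y 0) * g⁻¹ := by
      rw [Equiv.mul_swap_eq_swap_mul, g0, g1, mul_inv_cancel_right]
    have e2 : Equiv.swap c d = g * Equiv.swap (x 1) (y 1) * g⁻¹ := by
      rw [Equiv.mul_swap_eq_swap_mul, g2, g3, mul_inv_cancel_right]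
    rw [e1, e2, Lt_mul, Lt_mul, Lt_mul, Lt_mul, h01 _ (hW _ _ hw)]
  have h5 : ∀ a b c d : Fin n, a ≠ b → c ≠ d → ∀ w ∈ W,
      Lt (Equiv.swap a b) w = Lt (Equiv.swap c d) w := by
    intro a b c d hab hcd w hw
    have hcard : 1 < (({a, b, c, d} : Finset (Fin n))ᶜ).card := by
      rw [Finset.card_compl, Fintype.card_fin]
      have : ({a, b, c, d} : Finset (Fin n)).card ≤ 4 := Finset.card_le_four
      omega
    obtain ⟨p, hp, q, hq, hpq⟩ := Finset.one_lt_card.1 hcard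
    simp only [Finset.mem_compl, Finset.mem_insert, Finset.mem_singleton, not_or] at hp hq
    rw [h4 a b p q _ w hw, h4 c d p q _ w hw]
    · exact inj4 hcd (Ne.symm hp.2.2.1) (Ne.symm hq.2.2.1) (Ne.symm hp.2.2.2) (Ne.symm hq.2.2.2) hpq
    · exact inj4 hab (Ne.symm hp.1) (Ne.symm hq.1) (Ne.symm hp.2.1) (Ne.symm hq.2.1) hpq
  obtain ⟨w, hw, hw0⟩ := Submodule.exists_mem_ne_zero_of_ne_bot hW0
  set t := Equiv.swap (x 0) (y 0) with ht
  have hu : ∃ u ∈ W, u ≠ 0 ∧ (Lt t u = u ∨ Lt t u = -u) := by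
    by_cases hz : w + Lt t w = 0
    · exact ⟨w, hw, hw0, Or.inr (neg_eq_of_add_eq_zero_right hz).symm⟩
    · refine ⟨w + Lt t w, W.add_mem hw (hW _ _ hw), hz, Or.inl ?_⟩
      rw [map_add, swap_sq, add_comm]
  obtain ⟨u, huW, hu0, hut⟩ := hu
  obtain ⟨h, hh1, hh2⟩ := hno u huW hu0
  have hall : ∀ h : Equiv.Perm (Fin n), Lt h u = u ∨ Lt h u = -u := by
    intro h
    induction h using Equiv.Perm.swap_induction_on with
    | one => left; exact Lt_one u
    | swap_mul h a b hab ih =>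
      have e : Lt (Equiv.swap a b) u = Lt t u := h5 a b _ _ hab (hxy 0 0) u huW
      rw [Lt_mul]
      rcases ih with ih | ih <;> rcases hut with h' | h' <;> rw [ih] <;> simp [e, h']
  rcases hall h with h' | h'
  · exact hh1 h'
  · exact hh2 h'

end D
end QUE
namespace QUE
section E

/-- The adjacency operator on real functions. -/
noncomputable def adj {G : Type*} [Group G] [Fintype G] (S : Finset G) :
    EuclideanSpace ℝ G →ₗ[ℝ] EuclideanSpace ℝ G where
  toFun v := WithLp.toLp 2 (fun g => ∑ s ∈ S, v (g * s))
  map_add' u v := by ext g; simp [Finset.sum_add_distrib]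
  map_smul' c v := by ext g; simp [Finset.mul_sum]

variable {G : Type*} [Group G] [Fintype G]

lemma adj_apply (S : Finset G) (v : EuclideanSpace ℝ G) (g : G) : adj S v g = ∑ s ∈ S, v (g * s) := rfl

lemma adj_Lt (S : Finset G) (h : G) (v : EuclideanSpace ℝ G) : adj S (Lt h v) = Lt h (adj S v) := by
  ext g; simp [adj_apply, Lt_apply, mul_assoc]

lemma adj_symm (S : Finset G) (hS : ∀ s ∈ S, s⁻¹ ∈ S) : (adj S).IsSymmetric := by
  intro u v
  simp only [PiLp.inner_apply, adj_apply]
  simp only [RCLike.inner_apply, conj_trivial, Finset.mul_sum, Finset.sum_mul]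
  rw [Finset.sum_comm, Finset.sum_comm (s := Finset.univ) (t := S)]
  refine Finset.sum_bij' (fun s _ => s⁻¹) (fun s _ => s⁻¹) (fun s hs => hS s hs) (fun s hs => hS s hs)
    (by simp) (by simp) ?_
  intro s hs
  refine Fintype.sum_equiv (Equiv.mulRight s) _ _ ?_
  intro g
  simp

lemma assemble (A : EuclideanSpace ℝ G →ₗ[ℝ] EuclideanSpace ℝ G) (hA : A.IsSymmetric)
    (hAL : ∀ h v, A (Lt h v) = Lt h (A v)) (Q : EuclideanSpace ℝ G → Prop)
    (hstep : ∀ W : Submodule ℝ (EuclideanSpace ℝ G), (∀ h, ∀ w ∈ W, Lt h w ∈ W) → W ≠ ⊥ →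
      ∃ W' ≤ W, (∀ h, ∀ w ∈ W', Lt h w ∈ W') ∧ W' ≠ ⊥ ∧
        ∃ b : OrthonormalBasis (Fin (Module.finrank ℝ W')) ℝ W', ∀ k, Q (b k)) :
    ∀ d : ℕ, ∀ U : Submodule ℝ (EuclideanSpace ℝ G), Module.finrank ℝ U = d →
      (∀ h, ∀ w ∈ U, Lt h w ∈ U) → (∀ w ∈ U, A w ∈ U) →
      ∃ (ι : Type) (_ : Fintype ι) (b : ι → EuclideanSpace ℝ G), Orthonormal ℝ b ∧
        Fintype.card ι = d ∧ (∀ i, b i ∈ U) ∧ ∀ i, (∃ μ : ℝ, A (b i) = μ • b i) ∧ Q (b i) := by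
  intro d
  induction d using Nat.strong_induction_on with
  | _ d ih =>
  intro U hd hUL hUA
  by_cases hU : U = ⊥
  · subst hU
    refine ⟨Empty, inferInstance, fun e => e.elim, ⟨fun e => e.elim, fun e => e.elim⟩, ?_, fun e => e.elim, fun e => e.elim⟩
    rw [← hd]; simp
  have hnt : Nontrivial U := Submodule.nontrivial_iff_ne_bot.2 hU
  have hsym : (A.restrict hUA).IsSymmetric := hA.restrict_invariant hUA
  obtain ⟨v, hv⟩ := hsym.hasEigenvalue_iSup_of_finiteDimensional.exists_hasEigenvector
  obtain ⟨μ, hμ⟩ : ∃ μ : ℝ, A v = μ • (v : EuclideanSpace ℝ G) := by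
    have := congrArg Subtype.val hv.apply_eq_smul
    exact ⟨_, this⟩
  have hv0 : (v : EuclideanSpace ℝ G) ≠ 0 := fun h => hv.2 (Subtype.ext h)
  let E : Submodule ℝ (EuclideanSpace ℝ G) := U ⊓ Module.End.eigenspace A μ
  have hEmem : ∀ w, w ∈ E ↔ w ∈ U ∧ A w = μ • w := by
    intro w; simp [E, Module.End.mem_eigenspace_iff]
  have hEL : ∀ h, ∀ w ∈ E, Lt h w ∈ E := by
    intro h w hw
    rw [hEmem] at hw ⊢
    exact ⟨hUL h w hw.1, by rw [hAL, hw.2, map_smul]⟩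
  have hE0 : E ≠ ⊥ := by
    intro h
    have : (v : EuclideanSpace ℝ G) ∈ E := (hEmem _).2 ⟨v.2, hμ⟩
    rw [h] at this
    exact hv0 (by simpa using this)
  obtain ⟨W, hWE, hWL, hW0, b, hb⟩ := hstep E hEL hE0
  have hWmem : ∀ w ∈ W, w ∈ U ∧ A w = μ • w := fun w hw => (hEmem w).1 (hWE hw)
  have hWU : W ≤ U := fun w hw => (hWmem w hw).1
  have hfr := Submodule.finrank_add_inf_finrank_orthogonal hWU
  have hWpos : 0 < Module.finrank ℝ W := by
    have : Nontrivial W := Submodule.nontrivial_iff_ne_bot.2 hW0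
    exact Module.finrank_pos
  obtain ⟨ι, hι, c, hc, hcard, hcU, hcQ⟩ := ih (Module.finrank ℝ (Wᗮ ⊓ U : Submodule ℝ (EuclideanSpace ℝ G))) (by omega) (Wᗮ ⊓ U) rfl (by
      intro h w hw
      refine ⟨?_, hUL h w hw.2⟩
      rw [SetLike.mem_coe, Submodule.mem_orthogonal]
      intro u hu
      have h1 := (Lt h⁻¹).inner_map_map u (Lt h w)
      rw [← Lt_mul, inv_mul_cancel, Lt_one] at h1
      rw [← h1]
      exact (Submodule.mem_orthogonal _ _).1 hw.1 _ (hWL _ _ hu)) (by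
      intro w hw
      refine ⟨?_, hUA w hw.2⟩
      rw [SetLike.mem_coe, Submodule.mem_orthogonal]
      intro u hu
      rw [← hA, (hWmem u hu).2, inner_smul_left, (Submodule.mem_orthogonal _ _).1 hw.1 _ hu, mul_zero])
  refine ⟨Fin (Module.finrank ℝ W) ⊕ ι, inferInstance, Sum.elim (fun k => (b k : EuclideanSpace ℝ G)) c, ?_, ?_, ?_, ?_⟩
  · classical
    have hb' : Orthonormal ℝ (fun k => (b k : EuclideanSpace ℝ G)) :=
      b.orthonormal.comp_linearIsometry W.subtypeₗᵢ
    constructor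
    · rintro (k | i)
      · exact hb'.1 k
      · exact hc.1 i
    · rintro (k | i) (l | j) hne
      · exact hb'.2 (fun h => hne (by rw [h]))
      · exact (Submodule.mem_orthogonal _ _).1 (hcU j).1 _ (b k).2
      · exact (Submodule.mem_orthogonal' _ _).1 (hcU i).1 _ (b l).2
      · exact hc.2 (fun h => hne (by rw [h]))
  · rw [Fintype.card_sum, Fintype.card_fin, hcard]; omega
  · rintro (k | i)
    · exact hWU (b k).2
    · exact (hcU i).2
  · rintro (k | i)
    · exact ⟨⟨μ, (hWmem _ (b k).2).2⟩, hb k⟩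
    · exact hcQ i

lemma numeric (n M : ℕ) (D : ℝ) (hn : 100 ≤ n) (hM : 0 < M) (hMn : (M : ℝ) ≤ n) (hD : (n : ℝ) / 3 ≤ D) :
    16 * |Real.log (32 * D * M)| / √D ≤ 192 * Real.log n / √n := by
  have hn' : (100 : ℝ) ≤ n := by exact_mod_cast hn
  have hM' : (1 : ℝ) ≤ M := by exact_mod_cast hM
  have hD0 : 0 < D := by linarith
  have hlogn : 0 < Real.log n := Real.log_pos (by linarith)
  have hnonneg : 0 ≤ Real.log (32 * D * M) := Real.log_nonneg (by nlinarith)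
  rw [abs_of_nonneg hnonneg]
  have h1 : Real.log (32 * D * M) ≤ Real.log D + 2 * Real.log n := by
    have : 32 * D * M ≤ D * (n * n) := by nlinarith [mul_nonneg hD0.le (by linarith : (0:ℝ) ≤ n - M), mul_nonneg (mul_nonneg hD0.le (by linarith : (0:ℝ) ≤ n)) (by linarith : (0:ℝ) ≤ n - 32)]
    calc Real.log (32 * D * M) ≤ Real.log (D * (n * n)) := Real.log_le_log (by positivity) this
      _ = Real.log D + 2 * Real.log n := by
        rw [Real.log_mul (by positivity) (by positivity), Real.log_mul (by positivity) (by positivity)]; ring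
  have hexp2 : Real.exp 2 ≤ (n : ℝ) / 3 := by
    have : Real.exp 2 = Real.exp 1 * Real.exp 1 := by rw [← Real.exp_add]; norm_num
    have h := Real.exp_one_lt_d9
    have h0 := Real.exp_pos 1
    nlinarith
  have h2 : Real.log D / √D ≤ Real.log ((n : ℝ) / 3) / √((n : ℝ) / 3) :=
    Real.log_div_sqrt_antitoneOn (by simpa using hexp2) (by simpa using hexp2.trans hD) hD
  have h3 : Real.log ((n : ℝ) / 3) ≤ Real.log n := Real.log_le_log (by linarith) (by linarith)
  have hs : 1 / √((n : ℝ) / 3) ≤ 2 / √n := by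
    rw [div_le_div_iff₀ (by positivity) (by positivity), one_mul]
    apply Real.sqrt_le_iff.2
    refine ⟨by positivity, ?_⟩
    rw [mul_pow, Real.sq_sqrt (by positivity)]; linarith
  have hs2 : 1 / √D ≤ 2 / √n := by
    refine le_trans ?_ hs
    exact one_div_le_one_div_of_le (Real.sqrt_pos.2 (by linarith)) (Real.sqrt_le_sqrt hD)
  have h4 : Real.log ((n : ℝ) / 3) / √((n : ℝ) / 3) ≤ Real.log n * (2 / √n) := by
    rw [div_eq_mul_one_div]
    exact mul_le_mul h3 hs (by positivity) hlogn.le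
  calc 16 * Real.log (32 * D * M) / √D ≤ 16 * (Real.log D + 2 * Real.log n) / √D := by gcongr
    _ = 16 * (Real.log D / √D) + 32 * Real.log n * (1 / √D) := by ring
    _ ≤ 16 * (Real.log n * (2 / √n)) + 32 * Real.log n * (2 / √n) := by
        have := h2.trans h4
        gcongr
    _ = 96 * Real.log n / √n := by ring
    _ ≤ 192 * Real.log n / √n := by gcongr; norm_num

lemma step (n M : ℕ) (hn : 100 ≤ n) (hM : 0 < M) (hMn : (M : ℝ) ≤ n)
    (f : Fin M → Equiv.Perm (Fin n) → ℝ)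
    (W : Submodule ℝ (EuclideanSpace ℝ (Equiv.Perm (Fin n)))) (hW : ∀ h, ∀ w ∈ W, Lt h w ∈ W) (hW0 : W ≠ ⊥) :
    ∃ W' ≤ W, (∀ h, ∀ w ∈ W', Lt h w ∈ W') ∧ W' ≠ ⊥ ∧
        ∃ b : OrthonormalBasis (Fin (Module.finrank ℝ W')) ℝ W', ∀ k, ∀ i,
      |∑ g, f i g * (b k : EuclideanSpace ℝ (Equiv.Perm (Fin n))) g ^ 2 - (∑ g, f i g) / (Fintype.card (Equiv.Perm (Fin n)) : ℝ)| ≤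
        192 * Real.log n / √n *
          (√(∑ g, f i g ^ 2) / √(Fintype.card (Equiv.Perm (Fin n)) : ℝ)) := by
  have hlogn : 0 ≤ Real.log n := Real.log_natCast_nonneg n
  rcases rep_dichotomy (n / 2 - 2) (by omega) (by omega) W hW hW0 with hD | ⟨u, huW, hu0, hu⟩
  · refine ⟨W, le_rfl, hW, hW0, ?_⟩
    obtain ⟨b, hb⟩ := lemC W hW (by omega) f
    refine ⟨b, fun k i => (hb k i).trans ?_⟩
    refine mul_le_mul_of_nonneg_right ?_ (by positivity)
    rw [Fintype.card_fin]
    apply numeric n M _ hn hM hMn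
    have : n ≤ 3 * Module.finrank ℝ W := by omega
    have : (n : ℝ) ≤ 3 * Module.finrank ℝ W := by exact_mod_cast this
    linarith
  · refine ⟨Submodule.span ℝ {u}, by simpa using huW, ?_, by simpa using hu0, stdOrthonormalBasis ℝ _, ?_⟩
    · intro h w hw
      obtain ⟨c, rfl⟩ := Submodule.mem_span_singleton.1 hw
      rw [map_smul]
      rcases hu h with h' | h' <;> rw [h']
      · exact hw
      · rw [smul_neg]; exact Submodule.neg_mem _ hw
    · intro k i
      set φ := stdOrthonormalBasis ℝ (Submodule.span ℝ {u}) k with hφ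
      obtain ⟨c, hc⟩ := Submodule.mem_span_singleton.1 φ.2
      have husq : ∀ g, u g ^ 2 = u 1 ^ 2 := by
        intro g
        have := Lt_apply g u g
        rw [inv_mul_cancel] at this
        rcases hu g with h' | h' <;> rw [h'] at this
        · rw [this]
        · rw [← this]; simp
      have hφsq : ∀ g, (φ : EuclideanSpace ℝ (Equiv.Perm (Fin n))) g ^ 2 = c ^ 2 * u 1 ^ 2 := by
        intro g; rw [← hc, ← husq g]; simp [mul_pow]
      have hsum : ∑ g, (φ : EuclideanSpace ℝ (Equiv.Perm (Fin n))) g ^ 2 = 1 := by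
        rw [← EuclideanSpace.real_norm_sq_eq, ← Submodule.coe_norm, hφ, (stdOrthonormalBasis ℝ _).orthonormal.1 k]; norm_num
      simp only [hφsq] at hsum ⊢
      rw [Finset.sum_const, Finset.card_univ, nsmul_eq_mul] at hsum
      have hcard : (Fintype.card (Equiv.Perm (Fin n)) : ℝ) ≠ 0 := by exact_mod_cast Fintype.card_ne_zero
      have : c ^ 2 * u 1 ^ 2 = 1 / (Fintype.card (Equiv.Perm (Fin n)) : ℝ) := by
        rw [eq_div_iff hcard]; linarith
      rw [this, ← Finset.sum_mul, mul_one_div, sub_self, abs_zero]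
      positivity

end E
end QUE

/-- **QUE for Cayley graphs of symmetric groups** (Proposition 1.6, `Sym(n)` case). -/
theorem stmt_4
    (S : ∀ n : ℕ, Finset (Equiv.Perm (Fin n)))
    (hS : ∀ n, ∀ s ∈ S n, s⁻¹ ∈ S n)
    (M : ℕ → ℕ) (hMpos : ∀ n, 0 < M n)
    (hM : Filter.Tendsto (fun n : ℕ => (M n : ℝ) / n) Filter.atTop (nhds 0))
    (f : ∀ n : ℕ, Fin (M n) → Equiv.Perm (Fin n) → ℝ) :
    ∃ n₀ : ℕ, ∀ n, n₀ ≤ n →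
      ∃ B : OrthonormalBasis (Equiv.Perm (Fin n)) ℂ (EuclideanSpace ℂ (Equiv.Perm (Fin n))),
        (∀ φ : Equiv.Perm (Fin n), (∀ g, (B φ g).im = 0) ∧
          ∃ μ : ℂ, ∀ g, ∑ s ∈ S n, B φ (g * s) = μ * B φ g) ∧
        (∀ (φ : Equiv.Perm (Fin n)) (i : Fin (M n)),
          |(∑ g : Equiv.Perm (Fin n), f n i g * ‖B φ g‖ ^ 2) -
              (∑ g : Equiv.Perm (Fin n), f n i g) / (Fintype.card (Equiv.Perm (Fin n)) : ℝ)| ≤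
            192 * Real.log n / Real.sqrt n *
              (Real.sqrt (∑ g : Equiv.Perm (Fin n), f n i g ^ 2) /
                Real.sqrt (Fintype.card (Equiv.Perm (Fin n))))) := by
  obtain ⟨n₁, hn₁⟩ := Filter.eventually_atTop.1 (hM.eventually_lt_const (show (0 : ℝ) < 1 by norm_num))
  refine ⟨max n₁ 100, fun n hn => ?_⟩
  have hn100 : 100 ≤ n := le_of_max_le_right hn
  have hMn : (M n : ℝ) ≤ n := by
    have h1 := hn₁ n (le_of_max_le_left hn)
    have hpos : (0 : ℝ) < n := by exact_mod_cast (by omega : 0 < n)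
    rw [div_lt_one hpos] at h1
    exact h1.le
  obtain ⟨ι, hι, b, hb, hcard, -, hbQ⟩ := QUE.assemble (QUE.adj (S n)) (QUE.adj_symm (S n) (hS n))
    (QUE.adj_Lt (S n)) (fun v => ∀ i, |∑ g, f n i g * v g ^ 2 - (∑ g, f n i g) / (Fintype.card (Equiv.Perm (Fin n)) : ℝ)| ≤
        192 * Real.log n / √n * (√(∑ g, f n i g ^ 2) / √(Fintype.card (Equiv.Perm (Fin n)) : ℝ)))
    (fun W hW hW0 => QUE.step n (M n) hn100 (hMpos n) hMn (f n) W hW hW0) _ ⊤ rfl (by simp) (by simp)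
  have hcard' : Fintype.card (Equiv.Perm (Fin n)) = Fintype.card ι := by
    rw [hcard]; simp
  let e : Equiv.Perm (Fin n) ≃ ι := Fintype.equivOfCardEq hcard'
  let bC : Equiv.Perm (Fin n) → EuclideanSpace ℂ (Equiv.Perm (Fin n)) :=
    fun φ => WithLp.toLp 2 (fun g => ((b (e φ) g : ℝ) : ℂ))
  have hbC : Orthonormal ℂ bC := by
    classical
    rw [orthonormal_iff_ite]
    intro φ ψ
    have h1 := orthonormal_iff_ite.1 hb (e φ) (e ψ)
    have h2 : inner ℂ (bC φ) (bC ψ) = ((inner ℝ (b (e φ)) (b (e ψ)) : ℝ) : ℂ) := by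
      simp [PiLp.inner_apply, bC]
    rw [h2, h1]
    by_cases h : φ = ψ <;> simp [h]
  let B : OrthonormalBasis (Equiv.Perm (Fin n)) ℂ (EuclideanSpace ℂ (Equiv.Perm (Fin n))) :=
    OrthonormalBasis.mk hbC (hbC.linearIndependent.span_eq_top_of_card_eq_finrank' (by simp)).ge
  have hB : ∀ φ g, B φ g = ((b (e φ) g : ℝ) : ℂ) := fun φ g => by simp [B, bC]
  refine ⟨B, fun φ => ⟨fun g => ?_, ?_⟩, fun φ i => ?_⟩
  · rw [hB, Complex.ofReal_im]
  · obtain ⟨μ, hμ⟩ := (hbQ (e φ)).1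
    refine ⟨μ, fun g => ?_⟩
    have := congrArg (fun v => v g) hμ
    simp only [QUE.adj_apply, PiLp.smul_apply, smul_eq_mul] at this
    simp only [hB]
    rw [← Complex.ofReal_sum, this, Complex.ofReal_mul]
  · have := (hbQ (e φ)).2 i
    simp only [hB, Complex.norm_real, Real.norm_eq_abs, sq_abs]
    exact this
end
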